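/- Let f : (ℂ^n,0) → (ℂ,0) be a germ of holomorphic function with an isolated singularity at the origin, of algebraic multiplicity m, and suppose that the initial homogeneous term f_m of f does NOT have an isolated singularity at the origin (the partial derivatives of f_m have a common zero other than 0). Then the Milnor number of f at the origin satisfies μ_f > (m_f − 1)^n. -/

import Mathlib

open scoped Topology

set_option synthInstance.maxHeartbeats 1000000
set_option maxHeartbeats 1000000

noncomputable section

/-- `ℂⁿ` with the Euclidean norm. -/
abbrev En (n : ℕ) := EuclideanSpace ℂ (Fin n)

instance germAlgebra {α : Type*} (l : Filter α) : Algebra ℂ (Filter.Germ l ℂ) :=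
  ((Filter.Germ.coeRingHom l).comp (Pi.constRingHom α ℂ)).toAlgebra

/-- The ring `𝒪ₙ` of germs at `0` of holomorphic functions on `ℂⁿ`. -/
def AnalyticGerms (n : ℕ) : Subalgebra ℂ ((𝓝 (0 : En n)).Germ ℂ) where
  carrier := {g | ∃ f : En n → ℂ, AnalyticAt ℂ f 0 ∧ g = (f : (𝓝 (0 : En n)).Germ ℂ)}
  add_mem' := by
    rintro a b ⟨f, hf, rfl⟩ ⟨g, hg, rfl⟩
    exact ⟨f + g, hf.add hg, rfl⟩
  mul_mem' := by
    rintro a b ⟨f, hf, rfl⟩ ⟨g, hg, rfl⟩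
    exact ⟨f * g, hf.mul hg, rfl⟩
  algebraMap_mem' := fun c => ⟨fun _ => c, analyticAt_const, rfl⟩

/-- The germ at `0` of the `i`-th partial derivative `∂f/∂zᵢ` of `f`. -/
def partialGerm {n : ℕ} (f : En n → ℂ) (i : Fin n) : (𝓝 (0 : En n)).Germ ℂ :=
  (↑(fun z => fderiv ℂ f z (EuclideanSpace.single i 1)) : (𝓝 (0 : En n)).Germ ℂ)

/-- The Jacobian ideal `⟨∂f/∂z₁, …, ∂f/∂zₙ⟩` of `f` in the ring `𝒪ₙ` of holomorphic
germs at `0`. -/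
def jacobianIdeal {n : ℕ} (f : En n → ℂ) : Ideal (AnalyticGerms n) :=
  Ideal.span {g : AnalyticGerms n | ∃ i : Fin n, (g : (𝓝 (0 : En n)).Germ ℂ) = partialGerm f i}

/-- The Milnor number `μ_f` of `f` at the origin: the complex dimension of
`𝒪ₙ/⟨∂f/∂z₁, …, ∂f/∂zₙ⟩`. -/
def milnorNumber {n : ℕ} (f : En n → ℂ) : ℕ :=
  Module.finrank ℂ ((AnalyticGerms n) ⧸ jacobianIdeal f)

/-- `f` has algebraic multiplicity `ν` with initial homogeneous term `P`:
in the Taylor expansion `f = f_ν + f_{ν+1} + ⋯` of `f` at `0`, the homogeneous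
components of degree `< ν` vanish and the one of degree `ν` is `P ≠ 0`. -/
def HasInitialTerm {n : ℕ} (f : En n → ℂ) (ν : ℕ) (P : En n → ℂ) : Prop :=
  ∃ p : FormalMultilinearSeries ℂ (En n) ℂ, HasFPowerSeriesAt f p 0 ∧
    (∀ k < ν, ∀ z : En n, (p k fun _ => z) = 0) ∧
    (∀ z : En n, P z = p ν fun _ => z) ∧ P ≠ 0

/-- The origin is an isolated singularity of `f`: the gradient of `f` vanishes at `0`
and at no other point of some neighborhood of `0`. -/
def IsolatedSingularityAt0 {n : ℕ} (f : En n → ℂ) : Prop :=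
  fderiv ℂ f 0 = 0 ∧ ∃ U ∈ 𝓝 (0 : En n), ∀ z ∈ U, z ≠ 0 → fderiv ℂ f z ≠ 0

/-- The germs at `0` of the hypersurfaces `V_f = f⁻¹(0)` and `V_g = g⁻¹(0)` are
topologically equisingular: some homeomorphism between neighborhoods of `0`
fixes `0` and sends `f⁻¹(0) ∩ U` onto `g⁻¹(0) ∩ U'`. -/
def TopEquisingular {n : ℕ} (f g : En n → ℂ) : Prop :=
  ∃ U U' : Set (En n), U ∈ 𝓝 (0 : En n) ∧ U' ∈ 𝓝 (0 : En n) ∧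
    ∃ φ ψ : En n → En n, φ 0 = 0 ∧ ContinuousOn φ U ∧ ContinuousOn ψ U' ∧
      Set.MapsTo φ U U' ∧ Set.MapsTo ψ U' U ∧
      (∀ z ∈ U, ψ (φ z) = z) ∧ (∀ z ∈ U', φ (ψ z) = z) ∧
      φ '' (f ⁻¹' {0} ∩ U) = g ⁻¹' {0} ∩ U'

/-- `φ` is a germ of homeomorphism of `(X, 0)`: a homeomorphism between neighborhoods
of `0` fixing `0`. -/
def IsGermHomeoAt0 {X : Type*} [TopologicalSpace X] [Zero X] (φ : X → X) : Prop :=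
  ∃ U V : Set X, U ∈ 𝓝 (0 : X) ∧ V ∈ 𝓝 (0 : X) ∧ φ 0 = 0 ∧ ContinuousOn φ U ∧
    Set.MapsTo φ U V ∧ ∃ ψ : X → X, ContinuousOn ψ V ∧ Set.MapsTo ψ V U ∧
      (∀ x ∈ U, ψ (φ x) = x) ∧ (∀ y ∈ V, φ (ψ y) = y)

/-- `f` and `g` are topologically right-left equivalent:
`f = ψ ∘ g ∘ φ` near `0` for germs of homeomorphisms `φ` of `(ℂⁿ,0)` and `ψ` of `(ℂ,0)`. -/
def TopRightLeftEquiv {n : ℕ} (f g : En n → ℂ) : Prop :=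
  ∃ φ : En n → En n, ∃ ψ : ℂ → ℂ, IsGermHomeoAt0 φ ∧ IsGermHomeoAt0 ψ ∧
    ∀ᶠ z in 𝓝 (0 : En n), f z = ψ (g (φ z))

/-- Evaluation of a polynomial in `n` variables at a point of `ℂⁿ`. -/
def evalE {n : ℕ} (f : MvPolynomial (Fin n) ℂ) : En n → ℂ :=
  fun z => MvPolynomial.eval (fun i => z i) f

open Polynomial in
/-- If `c * h = Q * W` on an open set containing all roots of the split monic polynomial `W`, with
`h` and `Q` continuous and `h` nonvanishing at the roots of `W`, then `W` divides `c`. -/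
theorem prod_X_sub_C_dvd_of_mul_eq {U : Set ℂ} (hU : IsOpen U) {h Q : ℂ → ℂ}
    (hh : ContinuousOn h U) (hQ : ContinuousOn Q U) (s : Multiset ℂ) (hs : ∀ y ∈ s, y ∈ U)
    (hne : ∀ y ∈ s, h y ≠ 0) (c : ℂ[X])
    (heq : ∀ y ∈ U, c.eval y * h y = Q y * (s.map fun a => X - C a).prod.eval y) :
    (s.map fun a => X - C a).prod ∣ c := by
  induction s using Multiset.induction generalizing c with
  | empty => simp
  | cons a s ih =>
    have haU : a ∈ U := hs a (Multiset.mem_cons_self a s)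
    have hca : c.IsRoot a := by
      have := heq a haU
      simp only [Multiset.map_cons, Multiset.prod_cons, eval_mul, eval_sub, eval_X, eval_C,
        sub_self, zero_mul, mul_zero] at this
      exact (mul_eq_zero.mp this).resolve_right (hne a (Multiset.mem_cons_self a s))
    obtain ⟨c', rfl⟩ := dvd_iff_isRoot.mpr hca
    rw [Multiset.map_cons, Multiset.prod_cons]
    refine mul_dvd_mul_left _ (ih (fun y hy => hs y (Multiset.mem_cons_of_mem hy))
      (fun y hy => hne y (Multiset.mem_cons_of_mem hy)) c' ?_)
    have hpunct : Set.EqOn (fun y => c'.eval y * h y)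
        (fun y => Q y * (s.map fun a => X - C a).prod.eval y) (U \ {a}) := by
      intro y hy
      have := heq y hy.1
      simp only [Multiset.map_cons, Multiset.prod_cons, eval_mul, eval_sub, eval_X, eval_C] at this
      have hya : y - a ≠ 0 := sub_ne_zero.mpr hy.2
      apply mul_left_cancel₀ hya
      simp only
      linear_combination this
    intro y hy
    have hcl : U ⊆ closure (U \ {a}) := fun y hy =>
      (dense_compl_singleton a).open_subset_closure_inter hU hy
    exact hpunct.of_subset_closure (c'.continuous.continuousOn.mul hh)
      (hQ.mul (Polynomial.continuous _).continuousOn) Set.sdiff_subset hcl hy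

/-- The disc algebra: continuous functions on the closed unit disc of `ℂ` that are holomorphic in
the open unit disc. -/
def discSubalgebra : Subalgebra ℂ C(Metric.closedBall (0 : ℂ) 1, ℂ) where
  carrier := {u | ∃ U : ℂ → ℂ, DifferentiableOn ℂ U (Metric.ball 0 1) ∧
    ∀ y : Metric.closedBall (0 : ℂ) 1, U y = u y}
  add_mem' := by
    rintro u v ⟨U, hU, hUu⟩ ⟨V, hV, hVv⟩
    exact ⟨U + V, hU.add hV, fun y => by simp [hUu, hVv]⟩
  mul_mem' := by
    rintro u v ⟨U, hU, hUu⟩ ⟨V, hV, hVv⟩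
    exact ⟨U * V, hU.mul hV, fun y => by simp [hUu, hVv]⟩
  algebraMap_mem' := fun c => ⟨fun _ => c, differentiableOn_const c, fun _ => rfl⟩

theorem isClosed_discSubalgebra :
    IsClosed (discSubalgebra : Set C(Metric.closedBall (0 : ℂ) 1, ℂ)) := by
  classical
  refine IsSeqClosed.isClosed fun u v hu huv => ?_
  choose U hU hUu using hu
  let V : ℂ → ℂ := fun y => if h : y ∈ Metric.closedBall (0 : ℂ) 1 then v ⟨y, h⟩ else 0
  have hV : ∀ y : Metric.closedBall (0 : ℂ) 1, V y = v y := fun y => by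
    simp only [V, y.2, dite_true]
  refine ⟨V, ?_, hV⟩
  rw [ContinuousMap.tendsto_iff_tendstoUniformly] at huv
  have : TendstoUniformlyOn U V Filter.atTop (Metric.ball 0 1) := by
    rw [Metric.tendstoUniformlyOn_iff]
    rw [Metric.tendstoUniformly_iff] at huv
    intro ε hε
    filter_upwards [huv ε hε] with n hn y hy
    have := hn ⟨y, Metric.ball_subset_closedBall hy⟩
    rwa [← hUu n, ← hV] at this
  exact this.tendstoLocallyUniformlyOn.differentiableOn (Filter.Eventually.of_forall hU)
    Metric.isOpen_ball

/-- The disc algebra as a type, with its structure of commutative Banach algebra. -/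
def DiscAlgebra : Type := discSubalgebra

theorem analyticAt_clm_apply {X V W : Type*} [NormedAddCommGroup X] [NormedSpace ℂ X]
    [NormedAddCommGroup V] [NormedSpace ℂ V] [NormedAddCommGroup W] [NormedSpace ℂ W]
    {T : X → V →L[ℂ] W} {u : X → V} {x : X} (hT : AnalyticAt ℂ T x) (hu : AnalyticAt ℂ u x) :
    AnalyticAt ℂ (fun z => T z (u z)) x :=
  ((ContinuousLinearMap.id ℂ (V →L[ℂ] W)).analyticAt_bilinear (T x, u x)).comp₂ hT hu

namespace DiscAlgebra

instance : NormedCommRing DiscAlgebra := inferInstanceAs (NormedCommRing discSubalgebra)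

instance : NormedAlgebra ℂ DiscAlgebra := inferInstanceAs (NormedAlgebra ℂ discSubalgebra)

instance : CompleteSpace DiscAlgebra := isClosed_discSubalgebra.completeSpace_coe

/-- The element of the disc algebra defined by a function continuous on the closed disc and
holomorphic inside. -/
def ofFun (U : ℂ → ℂ) (hc : ContinuousOn U (Metric.closedBall 0 1))
    (hd : DifferentiableOn ℂ U (Metric.ball 0 1)) : DiscAlgebra :=
  ⟨⟨(Metric.closedBall 0 1).domRestrict U, continuousOn_iff_continuous_domRestrict.mp hc⟩,
    U, hd, fun _ => rfl⟩

/-- Evaluation at a point of the closed disc. -/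
def ev (y : Metric.closedBall (0 : ℂ) 1) : DiscAlgebra →L[ℂ] ℂ :=
  (ContinuousMap.evalCLM ℂ y).comp discSubalgebra.toSubmodule.subtypeL

@[simp] theorem ev_mul (y) (a b : DiscAlgebra) : ev y (a * b) = ev y a * ev y b := rfl

@[simp] theorem ev_pow (y) (a : DiscAlgebra) (k : ℕ) : ev y (a ^ k) = ev y a ^ k := by
  induction k with
  | zero => rfl
  | succ k ih => rw [pow_succ, pow_succ, ev_mul, ih]

theorem ext_ev {a b : DiscAlgebra} (h : ∀ y, ev y a = ev y b) : a = b :=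
  Subtype.ext (ContinuousMap.ext h)

/-- The center of the closed disc. -/
def center : Metric.closedBall (0 : ℂ) 1 := ⟨0, by simp⟩

/-- The coordinate function. -/
def coord : DiscAlgebra := ofFun id continuousOn_id differentiableOn_id

@[simp] theorem ev_coord (y) : ev y coord = y := rfl

@[simp] theorem ev_one (y) : ev y 1 = 1 := rfl

@[simp] theorem ev_ofFun (U : ℂ → ℂ) (hc hd) (y) : ev y (ofFun U hc hd) = U y := rfl

theorem exists_eq_add_coord_mul (a : DiscAlgebra) : ∃ b, a = ev center a • 1 + coord * b := by
  obtain ⟨U, hU, hUa⟩ := a.2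
  have hball : Metric.ball (0 : ℂ) 1 ∈ 𝓝 0 := Metric.ball_mem_nhds _ one_pos
  have hc : ContinuousOn U (Metric.closedBall 0 1) := by
    rw [continuousOn_iff_continuous_domRestrict]
    convert! a.1.continuous using 1
    exact funext hUa
  refine ⟨ofFun (dslope U 0) ?_ ?_, ext_ev fun y => ?_⟩
  · exact (continuousOn_dslope (Filter.mem_of_superset hball Metric.ball_subset_closedBall)).mpr
      ⟨hc, hU.differentiableAt hball⟩
  · exact (Complex.differentiableOn_dslope hball).mpr hU
  · have h1 : ev y a = U y := (hUa y).symm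
    have h2 : ev center a = U 0 := (hUa center).symm
    have := sub_smul_dslope U 0 (y : ℂ)
    simp only [map_add, map_smul, ev_one, ev_mul, ev_coord, ev_ofFun, h1, h2, smul_eq_mul] at this ⊢
    linear_combination -this

theorem coord_mul_injective {a b : DiscAlgebra} (h : coord * a = coord * b) : a = b := by
  have hev : ∀ y : Metric.closedBall (0 : ℂ) 1, (y : ℂ) ≠ 0 → ev y a = ev y b := fun y hy => by
    have := congrArg (ev y) h
    simpa [hy] using this
  obtain ⟨U, hU, hUa⟩ := (a - b).2
  have hball : Metric.ball (0 : ℂ) 1 ∈ 𝓝 0 := Metric.ball_mem_nhds _ one_pos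
  have h0 : U 0 = 0 := by
    have hcont : ContinuousAt U 0 := (hU.differentiableAt hball).continuousAt
    have h1 : Filter.Tendsto U (𝓝[≠] 0) (𝓝 (U 0)) := hcont.mono_left inf_le_left
    refine tendsto_nhds_unique h1 (Filter.Tendsto.congr' ?_ tendsto_const_nhds)
    filter_upwards [self_mem_nhdsWithin, mem_nhdsWithin_of_mem_nhds hball] with y hy hyb
    have hy' := hUa ⟨y, Metric.ball_subset_closedBall hyb⟩
    have hab := hev ⟨y, Metric.ball_subset_closedBall hyb⟩ hy
    rw [hy']
    exact (sub_eq_zero.mpr hab).symm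
  refine ext_ev fun y => ?_
  by_cases hy : (y : ℂ) = 0
  · have := hUa y
    rw [hy, h0] at this
    exact sub_eq_zero.mp this.symm
  · exact hev y hy

/-- The decomposition of an element of the disc algebra into its value at the center and a
multiple of the coordinate. -/
def splitEquiv : (ℂ × DiscAlgebra) ≃L[ℂ] DiscAlgebra :=
  ContinuousLinearEquiv.ofBijective
    (((ContinuousLinearMap.fst ℂ ℂ DiscAlgebra).smulRight 1) +
      (ContinuousLinearMap.mul ℂ DiscAlgebra coord).comp (ContinuousLinearMap.snd ℂ ℂ DiscAlgebra))
    (LinearMap.ker_eq_bot'.mpr (by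
      rintro ⟨c, a⟩ h
      have h : c • (1 : DiscAlgebra) + coord * a = 0 := h
      have hc : c = 0 := by simpa [center] using congrArg (ev center) h
      subst hc
      rw [zero_smul, zero_add, ← mul_zero coord] at h
      rw [coord_mul_injective h]
      rfl))
    (LinearMap.range_eq_top.mpr fun a => by
      obtain ⟨b, hb⟩ := exists_eq_add_coord_mul a
      exact ⟨(ev center a, b), hb.symm⟩)

/-- The bounded operator `a ↦ (a - a(0)) / y`. -/
def shift : DiscAlgebra →L[ℂ] DiscAlgebra :=
  (ContinuousLinearMap.snd ℂ ℂ DiscAlgebra).comp (splitEquiv.symm : DiscAlgebra →L[ℂ] _)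

theorem eq_add_coord_mul_shift (a : DiscAlgebra) : a = ev center a • 1 + coord * shift a := by
  obtain ⟨⟨c, b⟩, rfl⟩ := splitEquiv.surjective a
  have h1 : splitEquiv (c, b) = c • 1 + coord * b := rfl
  have h2 : shift (splitEquiv (c, b)) = b := by simp [shift]
  have h3 : ev center (splitEquiv (c, b)) = c := by simp [h1, center]
  rw [h2, h3, h1]

theorem eq_sum_add_pow_mul_shift (a : DiscAlgebra) (b : ℕ) :
    a = ∑ j ∈ Finset.range b, ev center ((shift ^ j) a) • coord ^ j
      + coord ^ b * (shift ^ b) a := by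
  induction b with
  | zero => simp
  | succ b ih =>
    rw [Finset.sum_range_succ, pow_succ' shift, mul_apply_eq_comp]
    conv_lhs => rw [ih, eq_add_coord_mul_shift ((shift ^ b) a)]
    rw [mul_add, mul_smul_comm, mul_one, add_assoc, pow_succ, mul_assoc]

/-- Evaluation of an element of the disc algebra near the center is a resolvent of `shift`. -/
theorem ev_eq_inverse (a : DiscAlgebra) {y : ℂ} (hy : ‖y‖ ≤ 1)
    (hu : IsUnit (1 - y • shift)) :
    ev ⟨y, by simpa using hy⟩ a = ev center (Ring.inverse (1 - y • shift) a) := by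
  set b := Ring.inverse (1 - y • shift) a with hb
  have hab : b - y • shift b = a := by
    have : ((1 - y • shift) * Ring.inverse (1 - y • shift)) a = a := by
      rw [Ring.mul_inverse_cancel _ hu]; rfl
    exact this
  have h := congrArg (ev ⟨y, by simpa using hy⟩) (eq_add_coord_mul_shift b)
  rw [← hab]
  simp only [map_add, map_sub, map_smul, ev_one, ev_mul, ev_coord, smul_eq_mul, mul_one] at h ⊢
  linear_combination h

theorem analyticAt_ev_center_inverse (a : DiscAlgebra) :
    AnalyticAt ℂ (fun p : DiscAlgebra × ℂ => ev center (Ring.inverse (1 - p.2 • shift) p.1))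
      (a, 0) := by
  have h1 : AnalyticAt ℂ (Ring.inverse : (DiscAlgebra →L[ℂ] DiscAlgebra) → _)
      (1 - (a, (0 : ℂ)).2 • shift) := by
    have h : (1 : DiscAlgebra →L[ℂ] DiscAlgebra) - (0 : ℂ) • shift = 1 := by
      rw [zero_smul ℂ shift, sub_zero]
    rw [h]
    exact analyticAt_inverse (𝕜 := ℂ) (1 : (DiscAlgebra →L[ℂ] DiscAlgebra)ˣ)
  have h2 : AnalyticAt ℂ (fun p : DiscAlgebra × ℂ => 1 - p.2 • shift) (a, 0) :=
    analyticAt_const.sub (analyticAt_snd.smul analyticAt_const)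
  have h3 := (AnalyticAt.fun_comp (f := fun p : DiscAlgebra × ℂ => 1 - p.2 • shift) h1 h2)
  exact (ev center).analyticAt _ |>.fun_comp (analyticAt_clm_apply h3 analyticAt_fst)

theorem eventually_isUnit : ∀ᶠ y : ℂ in 𝓝 0, IsUnit (1 - y • shift) := by
  have hcont : ContinuousAt (fun y : ℂ => 1 - y • shift) 0 := by fun_prop
  refine hcont.eventually (Units.isOpen.mem_nhds ?_)
  change IsUnit (1 - (0 : ℂ) • shift)
  rw [zero_smul ℂ shift, sub_zero]
  exact isUnit_one

end DiscAlgebra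

namespace DiscAlgebra

theorem norm_le_of_forall_ev {a : DiscAlgebra} {C : ℝ} (hC : 0 ≤ C) (h : ∀ y, ‖ev y a‖ ≤ C) :
    ‖a‖ ≤ C :=
  (ContinuousMap.norm_le _ hC).mpr h

variable {X : Type*} [NormedAddCommGroup X] [NormedSpace ℂ X]

/-- The linear map `(x, t) ↦ (x, y * t)`. -/
def scaleSnd (X : Type*) [NormedAddCommGroup X] [NormedSpace ℂ X] (y : ℂ) :
    X × ℂ →L[ℂ] X × ℂ :=
  (ContinuousLinearMap.fst ℂ X ℂ).prod (y • ContinuousLinearMap.snd ℂ X ℂ)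

@[simp] theorem scaleSnd_apply (y : ℂ) (z : X × ℂ) : scaleSnd X y z = (z.1, y * z.2) := rfl

theorem norm_scaleSnd_le {y : ℂ} (hy : ‖y‖ ≤ 1) (z : X × ℂ) : ‖scaleSnd X y z‖ ≤ ‖z‖ := by
  rw [scaleSnd_apply, Prod.norm_def, Prod.norm_def, norm_mul]
  exact max_le_max le_rfl (mul_le_of_le_one_left (norm_nonneg _) hy)

theorem differentiable_scaled {n : ℕ} (p : ContinuousMultilinearMap ℂ (fun _ : Fin n => X × ℂ) ℂ)
    (m : Fin n → X × ℂ) : Differentiable ℂ fun y => p fun i => scaleSnd X y (m i) :=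
  (p.contDiff (n := 1)).differentiable one_ne_zero |>.comp (differentiable_pi.mpr fun i => by
    simp only [scaleSnd_apply]
    fun_prop)

/-- The disc algebra valued multilinear map `m ↦ (y ↦ p ((x₁, y * t₁), …, (xₙ, y * tₙ)))`. -/
def liftMultilinear {n : ℕ} (p : ContinuousMultilinearMap ℂ (fun _ : Fin n => X × ℂ) ℂ) :
    ContinuousMultilinearMap ℂ (fun _ : Fin n => X × ℂ) DiscAlgebra :=
  MultilinearMap.mkContinuous
    { toFun := fun m => ofFun (fun y => p fun i => scaleSnd X y (m i))
        (differentiable_scaled p m).continuous.continuousOn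
        (differentiable_scaled p m).differentiableOn
      map_update_add' := fun m i u v => ext_ev fun y =>
        (p.toMultilinearMap.compLinearMap
          fun _ => (scaleSnd X (y : ℂ)).toLinearMap).map_update_add m i u v
      map_update_smul' := fun m i c u => ext_ev fun y =>
        (p.toMultilinearMap.compLinearMap
          fun _ => (scaleSnd X (y : ℂ)).toLinearMap).map_update_smul m i c u }
    ‖p‖ fun m => norm_le_of_forall_ev (by positivity) fun y => by
      refine (p.le_opNorm _).trans ?_
      gcongr with i
      exact norm_scaleSnd_le (mem_closedBall_zero_iff.mp y.2) _

theorem norm_liftMultilinear_le {n : ℕ}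
    (p : ContinuousMultilinearMap ℂ (fun _ : Fin n => X × ℂ) ℂ) : ‖liftMultilinear p‖ ≤ ‖p‖ :=
  MultilinearMap.mkContinuous_norm_le _ (norm_nonneg _) _

/-- An analytic function `f (x, t)` near `0` is evaluated at `(x, ρ y)` by an analytic family of
elements of the disc algebra, for all small `ρ`. -/
theorem exists_analyticAt_family {f : X × ℂ → ℂ} (hf : AnalyticAt ℂ f 0) :
    ∃ R > 0, ∀ ρ : ℂ, ‖ρ‖ < R → ∃ F : X → DiscAlgebra, AnalyticAt ℂ F 0 ∧
      ∀ x, ‖x‖ < R → ∀ y, ev y (F x) = f (x, y * ρ) := by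
  obtain ⟨p, r, hp⟩ := hf
  let P : FormalMultilinearSeries ℂ (X × ℂ) DiscAlgebra := fun n => liftMultilinear (p n)
  have hrad : p.radius ≤ P.radius :=
    FormalMultilinearSeries.radius_le_of_le fun n => norm_liftMultilinear_le (p n)
  have hr : r ≤ P.radius := hp.r_le.trans hrad
  have hP := P.hasFPowerSeriesOnBall (hp.r_pos.trans_le hr)
  obtain ⟨R, hR0, hRr⟩ := ENNReal.lt_iff_exists_nnreal_btwn.mp hp.r_pos
  have hmem : ∀ z : X × ℂ, ‖z‖ < R → z ∈ Metric.eball (0 : X × ℂ) r := fun z hz => by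
    rw [mem_eball_zero_iff]
    refine lt_trans ?_ hRr
    rw [← ofReal_norm]
    simpa using (ENNReal.ofReal_lt_coe_iff (norm_nonneg z)).mpr hz
  refine ⟨R, by simpa using hR0, fun ρ hρ => ⟨fun x => P.sum (x, ρ), ?_, fun x hx y => ?_⟩⟩
  · have h1 : AnalyticAt ℂ P.sum ((0 : X), ρ) :=
      hP.analyticAt_of_mem (Metric.eball_subset_eball hr (hmem _ (by simpa using hρ)))
    exact h1.fun_comp (f := fun x : X => (x, ρ)) (by fun_prop)
  · have hz : ‖((x, ρ) : X × ℂ)‖ < R := by simp [Prod.norm_def, hx, hρ]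
    have h1 := (ev y).hasSum (hP.hasSum (Metric.eball_subset_eball hr (hmem _ hz)))
    have h2 := hp.hasSum (hmem (scaleSnd X y (x, ρ))
      ((norm_scaleSnd_le (mem_closedBall_zero_iff.mp y.2) _).trans_lt hz))
    have h3 := h1.unique h2
    simpa using h3

end DiscAlgebra

open DiscAlgebra in
/-- **Weierstrass division**: if `g (0, ·)` vanishes to order exactly `b` at `0`, every `f` analytic
at `0` is, near `0`, a multiple of `g` plus a polynomial of degree `< b` in the last variable whose
coefficients are analytic in the other variables. -/
theorem weierstrass_division {X : Type*} [NormedAddCommGroup X] [NormedSpace ℂ X]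
    {f g : X × ℂ → ℂ} (hf : AnalyticAt ℂ f 0) (hg : AnalyticAt ℂ g 0) {b : ℕ} {k : ℂ → ℂ}
    (hk : AnalyticAt ℂ k 0) (hk0 : k 0 ≠ 0) (hgk : ∀ᶠ y in 𝓝 0, g (0, y) = y ^ b * k y) :
    ∃ q : X × ℂ → ℂ, AnalyticAt ℂ q 0 ∧ ∃ r : Fin b → X → ℂ, (∀ j, AnalyticAt ℂ (r j) 0) ∧
      ∀ᶠ z in 𝓝 0, f z = q z * g z + ∑ j, r j z.1 * z.2 ^ (j : ℕ) := by
  obtain ⟨Rf, hRf, hfF⟩ := exists_analyticAt_family hf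
  obtain ⟨Rg, hRg, hgG⟩ := exists_analyticAt_family hg
  obtain ⟨δ, hδ, hδk⟩ := Metric.eventually_nhds_iff_ball.mp
    (hk.eventually_analyticAt.and ((hk.continuousAt.eventually_ne hk0).and hgk))
  obtain ⟨ρ', hρ0, hρ'⟩ := exists_between (lt_min hRf (lt_min hRg hδ))
  obtain ⟨ρ, hρ⟩ : ∃ ρ : ℂ, ‖ρ‖ = ρ' := ⟨ρ', by simp [hρ0.le]⟩
  have hρne : ρ ≠ 0 := by rw [← norm_pos_iff, hρ]; exact hρ0
  rw [← hρ, lt_min_iff, lt_min_iff] at hρ'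
  obtain ⟨F, hFan, hF⟩ := hfF ρ hρ'.1
  obtain ⟨G, hGan, hG⟩ := hgG ρ hρ'.2.1
  have hmem : ∀ y : ℂ, y ∈ Metric.closedBall (0 : ℂ) 1 → y * ρ ∈ Metric.ball (0 : ℂ) δ := by
    intro y hy
    rw [mem_ball_zero_iff, norm_mul]
    exact (mul_le_of_le_one_left (norm_nonneg _) (mem_closedBall_zero_iff.mp hy)).trans_lt hρ'.2.2
  have hVan : ∀ y ∈ Metric.closedBall (0 : ℂ) 1,
      AnalyticAt ℂ (fun y => (ρ ^ b * k (y * ρ))⁻¹) y := by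
    intro y hy
    obtain ⟨h1, h2, -⟩ := hδk _ (hmem y hy)
    have h3 : AnalyticAt ℂ (fun y => k (y * ρ)) y := h1.fun_comp (f := fun y => y * ρ) (by fun_prop)
    exact (analyticAt_const.mul h3).inv (mul_ne_zero (pow_ne_zero _ hρne) h2)
  let v : DiscAlgebra := ofFun (fun y => (ρ ^ b * k (y * ρ))⁻¹)
    (fun y hy => (hVan y hy).continuousAt.continuousWithinAt)
    (fun y hy =>
      (hVan y (Metric.ball_subset_closedBall hy)).differentiableAt.differentiableWithinAt)
  have hGv : G 0 * v = coord ^ b := ext_ev fun y => by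
    obtain ⟨-, h2, h3⟩ := hδk _ (hmem y y.2)
    have hv : ev y v = (ρ ^ b * k (y * ρ))⁻¹ := rfl
    rw [ev_mul, hG 0 (by simpa using hRg), ev_pow, ev_coord, hv, h3, mul_pow]
    field_simp
  let S : DiscAlgebra →L[ℂ] DiscAlgebra :=
    (ContinuousLinearMap.mul ℂ DiscAlgebra v).comp (shift ^ b)
  let K : DiscAlgebra →L[ℂ] DiscAlgebra :=
    ∑ j ∈ Finset.range b, ((ev center).comp (shift ^ j)).smulRight (coord ^ j)
  let T : X → DiscAlgebra →L[ℂ] DiscAlgebra :=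
    fun x => (ContinuousLinearMap.mul ℂ DiscAlgebra (G x)).comp S + K
  have hT : ∀ x a, T x a = G x * (v * (shift ^ b) a)
      + ∑ j ∈ Finset.range b, ev center ((shift ^ j) a) • coord ^ j := fun x a => by
    simp [T, S, K]
  have hT0 : T 0 = 1 := by
    ext1 a
    rw [hT, ← mul_assoc, hGv, add_comm, ← eq_sum_add_pow_mul_shift]
    rfl
  have hTan : AnalyticAt ℂ T 0 := by
    let L : DiscAlgebra →L[ℂ] DiscAlgebra →L[ℂ] DiscAlgebra :=
      ((ContinuousLinearMap.compL ℂ DiscAlgebra DiscAlgebra DiscAlgebra).flip S).comp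
        (ContinuousLinearMap.mul ℂ DiscAlgebra)
    have h2 : AnalyticAt ℂ (fun x => L (G x)) 0 := (L.analyticAt (G 0)).fun_comp hGan
    exact h2.add analyticAt_const
  have hTunit : ∀ᶠ x in 𝓝 0, IsUnit (T x) :=
    hTan.continuousAt.eventually (Units.isOpen.mem_nhds (by
      change IsUnit (T 0)
      rw [hT0]
      exact isUnit_one))
  let h : X → DiscAlgebra := fun x => Ring.inverse (T x) (F x)
  have hh : AnalyticAt ℂ h 0 := by
    have h1 : AnalyticAt ℂ (Ring.inverse : (DiscAlgebra →L[ℂ] DiscAlgebra) → _) (T 0) := by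
      rw [hT0]
      exact analyticAt_inverse (𝕜 := ℂ) (1 : (DiscAlgebra →L[ℂ] DiscAlgebra)ˣ)
    exact analyticAt_clm_apply (h1.fun_comp hTan) hFan
  have hSh : AnalyticAt ℂ (fun x => S (h x)) 0 := (S.analyticAt _).fun_comp hh
  refine ⟨fun z => ev center (Ring.inverse (1 - (z.2 / ρ) • shift) (S (h z.1))), ?_,
    fun j x => ev center ((shift ^ (j : ℕ)) (h x)) / ρ ^ (j : ℕ), fun j => ?_, ?_⟩
  · have h1 : AnalyticAt ℂ (fun z : X × ℂ => (S (h z.1), z.2 / ρ)) 0 :=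
      (hSh.fun_comp (f := Prod.fst) (x := (0 : X × ℂ)) analyticAt_fst).prod
        (analyticAt_snd.div analyticAt_const hρne)
    have h2 := analyticAt_ev_center_inverse (S (h 0))
    refine AnalyticAt.fun_comp_of_eq (f := fun z : X × ℂ => (S (h z.1), z.2 / ρ)) h2 h1 ?_
    simp
  · have h1 := (((ev center).comp (shift ^ (j : ℕ))).analyticAt (h 0)).fun_comp hh
    exact h1.div analyticAt_const (pow_ne_zero _ hρne)
  · have hx : ∀ᶠ z : X × ℂ in 𝓝 0, IsUnit (T z.1) ∧ ‖z.1‖ < Rf ∧ ‖z.1‖ < Rg := by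
      have h1 : Filter.Tendsto (Prod.fst : X × ℂ → X) (𝓝 0) (𝓝 0) := continuous_fst.tendsto 0
      have h2 : Filter.Tendsto (fun x : X => ‖x‖) (𝓝 0) (𝓝 0) := by
        simpa using (continuous_norm (E := X)).tendsto 0
      exact h1.eventually
        (hTunit.and ((h2.eventually_lt_const hRf).and (h2.eventually_lt_const hRg)))
    have hy : ∀ᶠ z : X × ℂ in 𝓝 0, ‖z.2 / ρ‖ < 1 ∧ IsUnit (1 - (z.2 / ρ) • shift) := by
      have h1 : Filter.Tendsto (fun z : X × ℂ => z.2 / ρ) (𝓝 0) (𝓝 0) := by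
        have : Continuous fun z : X × ℂ => z.2 / ρ := by fun_prop
        simpa using this.tendsto 0
      have h2 : Filter.Tendsto (fun x : ℂ => ‖x‖) (𝓝 0) (𝓝 0) := by
        simpa using (continuous_norm (E := ℂ)).tendsto 0
      exact h1.eventually ((h2.eventually_lt_const one_pos).and eventually_isUnit)
    filter_upwards [hx, hy] with z ⟨hz1, hz2, hz3⟩ ⟨hz4, hz5⟩
    have h1 : T z.1 (h z.1) = F z.1 := by
      change (T z.1 * Ring.inverse (T z.1)) (F z.1) = F z.1
      rw [Ring.mul_inverse_cancel _ hz1]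
      rfl
    have hzρ : z.2 / ρ * ρ = z.2 := div_mul_cancel₀ _ hρne
    have h2 := congrArg (ev ⟨z.2 / ρ, by simpa using hz4.le⟩) h1
    rw [hF _ hz2, hT, map_add, ev_mul, hG _ hz3] at h2
    simp only [hzρ, map_sum, map_smul, ev_pow, ev_coord, smul_eq_mul] at h2
    have h3 := ev_eq_inverse (S (h z.1)) hz4.le hz5
    rw [← h3, ← h2, mul_comm, Finset.sum_range]
    congr 1
    refine Finset.sum_congr rfl fun j _ => ?_
    rw [div_pow]
    ring

/-- The algebra of functions on `E` that are analytic at `0`. -/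
def AnFun (E : Type*) [NormedAddCommGroup E] [NormedSpace ℂ E] : Subalgebra ℂ (E → ℂ) where
  carrier := {f | AnalyticAt ℂ f 0}
  add_mem' := fun hf hg => hf.add hg
  mul_mem' := fun hf hg => hf.mul hg
  algebraMap_mem' := fun _ => analyticAt_const

namespace AnFun

variable {E F : Type*} [NormedAddCommGroup E] [NormedSpace ℂ E]
  [NormedAddCommGroup F] [NormedSpace ℂ F]

theorem analyticAt (f : AnFun E) : AnalyticAt ℂ f.1 0 := f.2

/-- Composition with a linear map. -/
def pullback (φ : E →L[ℂ] F) : AnFun F →ₐ[ℂ] AnFun E where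
  toFun f := ⟨fun z => f.1 (φ z), (analyticAt f).fun_comp_of_eq (φ.analyticAt 0) (map_zero φ)⟩
  map_one' := rfl
  map_mul' _ _ := rfl
  map_zero' := rfl
  map_add' _ _ := rfl
  commutes' _ := rfl

@[simp] theorem pullback_apply (φ : E →L[ℂ] F) (f : AnFun F) (z : E) :
    (pullback φ f).1 z = f.1 (φ z) := rfl

/-- Evaluation at a point. -/
def evalAt (z : E) : AnFun E →+* ℂ := (Pi.evalRingHom (fun _ : E => ℂ) z).comp (AnFun E).val

theorem mem_of_eventuallyEq {J : Ideal (AnFun E)} (hJ : ∀ f : AnFun E, f.1 =ᶠ[𝓝 0] 0 → f ∈ J)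
    {f g : AnFun E} (hfg : f.1 =ᶠ[𝓝 0] g.1) (hg : g ∈ J) : f ∈ J := by
  have h : f - g ∈ J := hJ _ (by
    filter_upwards [hfg] with z hz
    exact sub_eq_zero.mpr hz)
  simpa using J.add_mem h hg

/-- Ideals defining the origin as an isolated point have finite codimension. -/
def FiniteCodim (E : Type*) [NormedAddCommGroup E] [NormedSpace ℂ E] : Prop :=
  ∀ (N : ℕ) (g : Fin N → AnFun E), (∀ᶠ z in 𝓝 0, (∀ i, (g i).1 z = 0) → z = 0) →
    ∀ J : Ideal (AnFun E), (∀ f : AnFun E, f.1 =ᶠ[𝓝 0] 0 → f ∈ J) → (∀ i, g i ∈ J) →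
      Module.Finite ℂ (AnFun E ⧸ J)

variable {X : Type*} [NormedAddCommGroup X] [NormedSpace ℂ X]

/-- The projection `(x, y) ↦ x` induces the inclusion of functions of `x`. -/
def fstHom (X : Type*) [NormedAddCommGroup X] [NormedSpace ℂ X] : AnFun X →ₐ[ℂ] AnFun (X × ℂ) :=
  pullback (ContinuousLinearMap.fst ℂ X ℂ)

/-- The function `(x, y) ↦ y`. -/
def sndFun (X : Type*) [NormedAddCommGroup X] [NormedSpace ℂ X] : AnFun (X × ℂ) :=
  ⟨Prod.snd, analyticAt_snd⟩

theorem sum_apply {κ : Type*} (s : Finset κ) (f : κ → AnFun E) (z : E) :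
    (∑ j ∈ s, f j).1 z = ∑ j ∈ s, (f j).1 z := map_sum (evalAt z) f s

/-- The polynomial in `y` with coefficients `r j`. -/
def ofCoeffs {b : ℕ} (r : Fin b → AnFun X) : AnFun (X × ℂ) :=
  ∑ j, fstHom X (r j) * sndFun X ^ (j : ℕ)

theorem ofCoeffs_apply {b : ℕ} (r : Fin b → AnFun X) (z : X × ℂ) :
    (ofCoeffs r).1 z = ∑ j, (r j).1 z.1 * z.2 ^ (j : ℕ) := by
  rw [ofCoeffs, sum_apply]
  rfl

/-- The polynomial `Y ^ b - ∑ w j (x) Y ^ j`. -/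
def monicPoly {b : ℕ} (w : Fin b → AnFun X) (x : X) : Polynomial ℂ :=
  Polynomial.X ^ b - ∑ j, Polynomial.C ((w j).1 x) * Polynomial.X ^ (j : ℕ)

theorem eval_monicPoly {b : ℕ} (w : Fin b → AnFun X) (x : X) (y : ℂ) :
    (monicPoly w x).eval y = (sndFun X ^ b - ofCoeffs w).1 (x, y) := by
  have h : (sndFun X ^ b - ofCoeffs w).1 (x, y) = y ^ b - (ofCoeffs w).1 (x, y) := rfl
  rw [h, ofCoeffs_apply]
  simp [monicPoly, Polynomial.eval_finsetSum]

theorem degree_sum_lt {b : ℕ} (c : Fin b → ℂ) :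
    (∑ j, Polynomial.C (c j) * Polynomial.X ^ (j : ℕ)).degree < (b : WithBot ℕ) := by
  refine (Polynomial.degree_sum_le _ _).trans_lt ((Finset.sup_lt_iff (WithBot.bot_lt_coe b)).mpr ?_)
  intro j _
  exact (Polynomial.degree_C_mul_X_pow_le _ _).trans_lt (Nat.cast_lt.mpr j.2)

theorem monic_monicPoly {b : ℕ} (w : Fin b → AnFun X) (x : X) : (monicPoly w x).Monic :=
  Polynomial.monic_X_pow_sub (degree_sum_lt _)

theorem degree_monicPoly {b : ℕ} (w : Fin b → AnFun X) (x : X) : (monicPoly w x).degree = b := by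
  rw [monicPoly, Polynomial.degree_sub_eq_left_of_degree_lt, Polynomial.degree_X_pow]
  rw [Polynomial.degree_X_pow]
  exact degree_sum_lt _

theorem coeff_sum_C_mul_X_pow {b : ℕ} (c : Fin b → ℂ) (i : Fin b) :
    (∑ j, Polynomial.C (c j) * Polynomial.X ^ (j : ℕ)).coeff i = c i := by
  simp [Polynomial.coeff_X_pow, Fin.val_inj]

theorem eventually_ball_prod {Y : Type*} [SeminormedAddCommGroup Y] {p : Y × ℂ → Prop}
    (h : ∀ᶠ z in 𝓝 0, p z) :
    ∃ δ > 0, ∀ x : Y, ‖x‖ < δ → ∀ y : ℂ, ‖y‖ < δ → p (x, y) := by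
  obtain ⟨δ, hδ, h⟩ := Metric.eventually_nhds_iff_ball.mp h
  exact ⟨δ, hδ, fun x hx y hy => h _ (by simp [Prod.norm_def, hx, hy])⟩

theorem eventually_norm_lt {Y : Type*} [SeminormedAddCommGroup Y] {δ : ℝ} (hδ : 0 < δ) :
    ∀ᶠ y : Y in 𝓝 0, ‖y‖ < δ := by
  have h : Filter.Tendsto (fun y : Y => ‖y‖) (𝓝 0) (𝓝 0) := by
    simpa using (continuous_norm (E := Y)).tendsto 0
  exact h.eventually_lt_const hδ

/-- If the lower coefficients vanish at `0`, the roots are close to `0` near `x = 0`. -/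
theorem eventually_roots_small {b : ℕ} {w : Fin b → AnFun X} (hw : ∀ j, (w j).1 0 = 0)
    {ε : ℝ} (hε : 0 < ε) :
    ∀ᶠ x in 𝓝 0, ∀ y, (monicPoly w x).eval y = 0 → ‖y‖ < ε := by
  wlog hε1 : ε ≤ 1 generalizing ε
  · filter_upwards [this one_pos le_rfl] with x hx y hy
    exact (hx y hy).trans (not_le.mp hε1)
  have hη : 0 < ε ^ b / (b + 1) := by positivity
  have h : ∀ᶠ x in 𝓝 0, ∀ j, ‖(w j).1 x‖ < ε ^ b / (b + 1) := by
    refine Filter.eventually_all.mpr fun j => ?_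
    have h1 : Filter.Tendsto (fun x => ‖(w j).1 x‖) (𝓝 0) (𝓝 0) := by
      simpa [hw j] using (analyticAt (w j)).continuousAt.norm.tendsto
    exact h1.eventually_lt_const hη
  filter_upwards [h] with x hx y hy
  by_contra! hεy
  have hy0 : 0 < ‖y‖ := hε.trans_le hεy
  have h1 : y ^ b = ∑ j, (w j).1 x * y ^ (j : ℕ) := by
    simpa [monicPoly, Polynomial.eval_finsetSum, sub_eq_zero] using hy
  have h2 : ‖y‖ ^ b ≤ ∑ j : Fin b, ‖y‖ ^ b / (b + 1) := by
    rw [← norm_pow]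
    conv_lhs => rw [h1]
    refine (norm_sum_le _ _).trans (Finset.sum_le_sum fun j _ => ?_)
    rw [norm_mul, norm_pow]
    have h3 : ε ^ b ≤ ‖y‖ ^ (b - (j : ℕ)) := calc
      ε ^ b ≤ ε ^ (b - (j : ℕ)) := pow_le_pow_of_le_one hε.le hε1 (Nat.sub_le _ _)
      _ ≤ _ := pow_le_pow_left₀ hε.le hεy _
    calc ‖(w j).1 x‖ * ‖y‖ ^ (j : ℕ) ≤ ‖y‖ ^ (b - (j : ℕ)) / (b + 1) * ‖y‖ ^ (j : ℕ) := by
          gcongr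
          exact (hx j).le.trans (by gcongr)
      _ = ‖y ^ b‖ / (b + 1) := by
          rw [norm_pow, div_mul_eq_mul_div, ← pow_add, Nat.sub_add_cancel j.2.le]
  rw [Finset.sum_const, Finset.card_univ, Fintype.card_fin, nsmul_eq_mul, mul_div_assoc',
    le_div_iff₀ (by positivity)] at h2
  nlinarith [pow_pos hy0 b]

/-- Division by an element regular of order `b` in `y`. -/
theorem exists_div {g : AnFun (X × ℂ)} {b : ℕ} {k : ℂ → ℂ} (hk : AnalyticAt ℂ k 0) (hk0 : k 0 ≠ 0)
    (hgk : ∀ᶠ y in 𝓝 0, g.1 (0, y) = y ^ b * k y) (f : AnFun (X × ℂ)) :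
    ∃ (q : AnFun (X × ℂ)) (r : Fin b → AnFun X), f.1 =ᶠ[𝓝 0] (q * g + ofCoeffs r).1 := by
  obtain ⟨q, hq, r, hr, h⟩ := weierstrass_division (analyticAt f) (analyticAt g) hk hk0 hgk
  refine ⟨⟨q, hq⟩, fun j => ⟨r j, hr j⟩, h.mono fun z hz => hz.trans ?_⟩
  have h1 := ofCoeffs_apply (fun j => (⟨r j, hr j⟩ : AnFun X)) z
  exact congrArg (q z * g.1 z + ·) h1.symm

/-- **Weierstrass preparation**: an ideal containing an element regular of order `b` in `y` contains
a Weierstrass polynomial of degree `b`. -/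
theorem exists_monicPoly_mem {J : Ideal (AnFun (X × ℂ))}
    (hJ : ∀ f : AnFun (X × ℂ), f.1 =ᶠ[𝓝 0] 0 → f ∈ J) {g : AnFun (X × ℂ)} (hgJ : g ∈ J)
    {b : ℕ} {k : ℂ → ℂ} (hk : AnalyticAt ℂ k 0) (hk0 : k 0 ≠ 0)
    (hgk : ∀ᶠ y in 𝓝 0, g.1 (0, y) = y ^ b * k y) :
    ∃ w : Fin b → AnFun X, (∀ j, (w j).1 0 = 0) ∧ sndFun X ^ b - ofCoeffs w ∈ J := by
  obtain ⟨q, w, h⟩ := exists_div hk hk0 hgk (sndFun X ^ b)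
  refine ⟨w, fun j => ?_, mem_of_eventuallyEq hJ (g := q * g) ?_ (J.mul_mem_left _ hgJ)⟩
  · have hpair : Filter.Tendsto (fun y : ℂ => ((0 : X), y)) (𝓝 0) (𝓝 0) := by
      have : Continuous fun y : ℂ => ((0 : X), y) := by fun_prop
      exact this.tendsto 0
    have hq : AnalyticAt ℂ (fun y : ℂ => q.1 (0, y)) 0 :=
      (analyticAt q).fun_comp_of_eq (f := fun y : ℂ => ((0 : X), y)) (by fun_prop) rfl
    obtain ⟨δ, hδ, hball⟩ := Metric.eventually_nhds_iff_ball.mp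
      ((hpair.eventually h).and (hgk.and (hq.eventually_analyticAt.and hk.eventually_analyticAt)))
    have hdvd := prod_X_sub_C_dvd_of_mul_eq (U := Metric.ball 0 δ) Metric.isOpen_ball
      (h := fun _ => 1) (Q := fun y => 1 - q.1 (0, y) * k y) continuousOn_const
      (fun y hy => by
        obtain ⟨-, -, h1, h2⟩ := hball y hy
        exact (continuousAt_const.sub (h1.continuousAt.mul h2.continuousAt)).continuousWithinAt)
      (Multiset.replicate b 0)
      (fun y hy => by rw [Multiset.eq_of_mem_replicate hy]; exact Metric.mem_ball_self hδ)
      (fun _ _ => one_ne_zero)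
      (∑ j, Polynomial.C ((w j).1 0) * Polynomial.X ^ (j : ℕ)) (fun y hy => by
        obtain ⟨h1, h2, -⟩ := hball y hy
        have h3 : y ^ b = q.1 (0, y) * g.1 (0, y) + (ofCoeffs w).1 (0, y) := h1
        rw [ofCoeffs_apply, h2] at h3
        simp only [Polynomial.eval_finsetSum, Polynomial.eval_mul, Polynomial.eval_C,
          Polynomial.eval_pow, Polynomial.eval_X, Multiset.map_replicate, map_zero, sub_zero,
          Multiset.prod_replicate]
        linear_combination -h3)
    rw [Multiset.map_replicate, Multiset.prod_replicate, map_zero, sub_zero] at hdvd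
    have h0 := Polynomial.eq_zero_of_dvd_of_degree_lt hdvd (by
      rw [Polynomial.degree_X_pow]
      exact degree_sum_lt _)
    rw [← coeff_sum_C_mul_X_pow (fun j => (w j).1 0) j, h0, Polynomial.coeff_zero]
  · filter_upwards [h] with z hz
    have h1 : (sndFun X ^ b).1 z = (q * g).1 z + (ofCoeffs w).1 z := hz
    exact sub_eq_iff_eq_add.mpr h1

end AnFun

namespace AnFun

variable {X : Type*} [NormedAddCommGroup X] [NormedSpace ℂ X]

/-- Elimination of `y`: an element of an ideal containing a Weierstrass polynomial yields an element
`D` of the ideal which is a function of `x` and whose zeros lift to common zeros. -/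
theorem exists_resultant {J : Ideal (AnFun (X × ℂ))}
    (hJ : ∀ f : AnFun (X × ℂ), f.1 =ᶠ[𝓝 0] 0 → f ∈ J) {b : ℕ} {w : Fin b → AnFun X}
    (hw : ∀ j, (w j).1 0 = 0) (hwJ : sndFun X ^ b - ofCoeffs w ∈ J) {h : AnFun (X × ℂ)}
    (hh : h ∈ J) :
    ∃ D : AnFun X, fstHom X D ∈ J ∧
      ∀ᶠ x in 𝓝 0, D.1 x = 0 → ∃ y, (monicPoly w x).eval y = 0 ∧ h.1 (x, y) = 0 := by
  set W := sndFun X ^ b - ofCoeffs w with hW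
  have hW0 : ∀ᶠ y in 𝓝 0, W.1 (0, y) = y ^ b * (fun _ => (1 : ℂ)) y := .of_forall fun y => by
    rw [hW, ← eval_monicPoly]
    simp [monicPoly, hw]
  choose q r hqr using fun i : Fin b =>
    exists_div analyticAt_const one_ne_zero hW0 (h * sndFun X ^ (i : ℕ))
  have hrJ : ∀ i, ofCoeffs (r i) ∈ J := fun i => by
    refine mem_of_eventuallyEq hJ (g := h * sndFun X ^ (i : ℕ) - q i * W) ?_
      (J.sub_mem (J.mul_mem_right _ hh) (J.mul_mem_left _ hwJ))
    filter_upwards [hqr i] with z hz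
    have h1 : (h * sndFun X ^ (i : ℕ)).1 z = (q i * W).1 z + (ofCoeffs (r i)).1 z := hz
    exact eq_sub_of_add_eq' h1.symm
  let A : Matrix (Fin b) (Fin b) (AnFun X) := Matrix.of r
  refine ⟨A.det, ?_, ?_⟩
  · rcases Nat.eq_zero_or_pos b with rfl | hb
    · have h1 : W = 1 := by simp [hW, ofCoeffs]
      rw [(J.eq_top_iff_one).mpr (h1 ▸ hwJ)]
      trivial
    · have h1 : fstHom X A.det = ∑ i, fstHom X (A.adjugate ⟨0, hb⟩ i) * ofCoeffs (r i) := by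
        have h2 : ∀ j, ∑ i, A.adjugate ⟨0, hb⟩ i * A i j = if j = ⟨0, hb⟩ then A.det else 0 := by
          intro j
          have := congrFun (congrFun A.adjugate_mul ⟨0, hb⟩) j
          simpa [Matrix.mul_apply, Matrix.one_apply, eq_comm] using this
        calc fstHom X A.det
            = ∑ j : Fin b, fstHom X (if j = (⟨0, hb⟩ : Fin b) then A.det else 0)
                * sndFun X ^ (j : ℕ) := by
              rw [Finset.sum_eq_single (⟨0, hb⟩ : Fin b)] <;> simp +contextual
          _ = ∑ j, (∑ i, fstHom X (A.adjugate ⟨0, hb⟩ i) * fstHom X (r i j)) *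
                sndFun X ^ (j : ℕ) := by
              refine Finset.sum_congr rfl fun j _ => ?_
              rw [← h2, map_sum]
              simp [A]
          _ = _ := by
              simp only [ofCoeffs, Finset.sum_mul, Finset.mul_sum]
              rw [Finset.sum_comm]
              simp only [mul_assoc]
      rw [h1]
      exact J.sum_mem fun i _ => J.mul_mem_left _ (hrJ i)
  · obtain ⟨δ, hδ, hball⟩ := eventually_ball_prod ((Filter.eventually_all.mpr hqr).and
      ((analyticAt h).eventually_analyticAt.and
        (Filter.eventually_all.mpr fun i => (analyticAt (q i)).eventually_analyticAt)))
    filter_upwards [eventually_norm_lt hδ, eventually_roots_small hw hδ] with x hx hroots hdet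
    have hdet' : (A.map (evalAt x)).det = 0 := by
      rw [← RingHom.mapMatrix_apply, ← RingHom.map_det]
      exact hdet
    obtain ⟨c, hc0, hc⟩ := Matrix.exists_vecMul_eq_zero_iff.mpr hdet'
    have hsplits : ((monicPoly w x).roots.map fun a => Polynomial.X - Polynomial.C a).prod
        = monicPoly w x :=
      (IsAlgClosed.splits (monicPoly w x)).eq_prod_roots_of_monic (monic_monicPoly w x) |>.symm
    by_contra! hno
    have hcont : ∀ f : AnFun (X × ℂ), (∀ y, ‖y‖ < δ → AnalyticAt ℂ f.1 (x, y)) →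
        ContinuousOn (fun y => f.1 (x, y)) (Metric.ball 0 δ) := fun f hf y hy =>
      ((hf y (mem_ball_zero_iff.mp hy)).continuousAt.comp
        (f := fun y : ℂ => (x, y)) (by fun_prop)).continuousWithinAt
    have hdvd := prod_X_sub_C_dvd_of_mul_eq (U := Metric.ball 0 δ) Metric.isOpen_ball
      (h := fun y => h.1 (x, y)) (Q := fun y => ∑ i, c i * (q i).1 (x, y))
      (hcont h fun y hy => (hball x hx y hy).2.1)
      (continuousOn_finsetSum _ fun i _ =>
        continuousOn_const.mul (hcont (q i) fun y hy => (hball x hx y hy).2.2 i))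
      (monicPoly w x).roots
      (fun y hy => mem_ball_zero_iff.mpr (hroots y (Polynomial.isRoot_of_mem_roots hy)))
      (fun y hy => hno y (Polynomial.isRoot_of_mem_roots hy))
      (∑ i, Polynomial.C (c i) * Polynomial.X ^ (i : ℕ)) (fun y hy => by
        have h1 : ∀ i : Fin b, h.1 (x, y) * y ^ (i : ℕ)
            = (q i).1 (x, y) * W.1 (x, y) + (ofCoeffs (r i)).1 (x, y) :=
          (hball x hx y (mem_ball_zero_iff.mp hy)).1
        have h2 : ∑ i, c i * (ofCoeffs (r i)).1 (x, y) = 0 := by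
          simp only [ofCoeffs_apply, Finset.mul_sum]
          rw [Finset.sum_comm]
          refine Finset.sum_eq_zero fun j _ => ?_
          have h3 : ∑ i, c i * (r i j).1 x = 0 := congrFun hc j
          simp only [← mul_assoc]
          rw [← Finset.sum_mul, h3, zero_mul]
        rw [hsplits, eval_monicPoly, Polynomial.eval_finsetSum]
        simp only [Polynomial.eval_mul, Polynomial.eval_C, Polynomial.eval_pow, Polynomial.eval_X]
        have h4 : (∑ i, c i * y ^ (i : ℕ)) * h.1 (x, y)
            = ∑ i, (c i * (q i).1 (x, y) * W.1 (x, y) + c i * (ofCoeffs (r i)).1 (x, y)) := by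
          rw [Finset.sum_mul]
          refine Finset.sum_congr rfl fun i _ => ?_
          linear_combination c i * h1 i
        rw [h4, Finset.sum_add_distrib, h2, add_zero, Finset.sum_mul])
    rw [hsplits] at hdvd
    have h0 := Polynomial.eq_zero_of_dvd_of_degree_lt hdvd (by
      rw [degree_monicPoly]
      exact degree_sum_lt _)
    refine hc0 (funext fun i => ?_)
    rw [← coeff_sum_C_mul_X_pow c i, h0, Polynomial.coeff_zero]
    rfl

end AnFun

namespace AnFun

variable {X : Type*} [NormedAddCommGroup X] [NormedSpace ℂ X]

/-- The finiteness property is inherited by ideals of functions on `X × ℂ` one of whose elements is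
regular in the last variable. -/
theorem finite_of_regular (hX : FiniteCodim X) {N : ℕ} {g : Fin N → AnFun (X × ℂ)}
    (hg : ∀ᶠ z in 𝓝 0, (∀ i, (g i).1 z = 0) → z = 0) {J : Ideal (AnFun (X × ℂ))}
    (hJ : ∀ f : AnFun (X × ℂ), f.1 =ᶠ[𝓝 0] 0 → f ∈ J) (hgJ : ∀ i, g i ∈ J) {i₀ : Fin N} {b : ℕ}
    {k : ℂ → ℂ} (hk : AnalyticAt ℂ k 0) (hk0 : k 0 ≠ 0)
    (hgk : ∀ᶠ y in 𝓝 0, (g i₀).1 (0, y) = y ^ b * k y) :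
    Module.Finite ℂ (AnFun (X × ℂ) ⧸ J) := by
  obtain ⟨w, hw, hwJ⟩ := exists_monicPoly_mem hJ (hgJ i₀) hk hk0 hgk
  let h : ℕ → AnFun (X × ℂ) := fun t => ∑ i : Fin N, (t : ℂ) ^ (i : ℕ) • g i
  have hh : ∀ t, h t ∈ J := fun t => J.sum_mem fun i _ => Submodule.smul_of_tower_mem J _ (hgJ i)
  choose D hDJ hD using fun t => exists_resultant hJ hw hwJ (hh t)
  have hfin : Module.Finite ℂ (AnFun X ⧸ J.comap (fstHom X)) := by
    refine hX (b * N + 1) (fun t => D t) ?_ _ (fun f hf => hJ _ ?_) fun t => hDJ t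
    · obtain ⟨δ, hδ, hball⟩ := eventually_ball_prod hg
      filter_upwards [eventually_norm_lt hδ, eventually_roots_small hw hδ,
        Filter.eventually_all.mpr fun t : Fin (b * N + 1) => hD t] with x hx hroots hres h0
      choose y hy hhy using fun t : Fin (b * N + 1) => hres t (h0 t)
      have hne := (monic_monicPoly w x).ne_zero
      have hcard : (monicPoly w x).roots.toFinset.card * N
          < (Finset.univ : Finset (Fin (b * N + 1))).card := by
        rw [Finset.card_univ, Fintype.card_fin, Nat.lt_succ_iff]
        refine Nat.mul_le_mul_right _ ((Multiset.toFinset_card_le _).trans ?_)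
        refine (Polynomial.card_roots' _).trans (Polynomial.natDegree_le_iff_degree_le.mpr ?_)
        rw [degree_monicPoly]
      obtain ⟨y₀, hy₀, hcard'⟩ := Finset.exists_lt_card_fiber_of_mul_lt_card_of_maps_to
        (f := y) (fun t _ => Multiset.mem_toFinset.mpr
          ((Polynomial.mem_roots hne).mpr (hy t))) hcard
      have hp : ∑ i, Polynomial.C ((g i).1 (x, y₀)) * Polynomial.X ^ (i : ℕ) = 0 := by
        refine Polynomial.eq_zero_of_degree_lt_of_eval_finset_eq_zero
          ((Finset.univ.filter fun t => y t = y₀).image fun t : Fin (b * N + 1) => ((t : ℕ) : ℂ))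
          ?_ ?_
        · rw [Finset.card_image_of_injective _ fun s t hst => Fin.ext (Nat.cast_injective hst)]
          exact (degree_sum_lt _).trans (Nat.cast_lt.mpr hcard')
        · intro t ht
          obtain ⟨s, hs, rfl⟩ := Finset.mem_image.mp ht
          rw [← (Finset.mem_filter.mp hs).2, Polynomial.eval_finsetSum, ← hhy s, sum_apply]
          refine Finset.sum_congr rfl fun i _ => ?_
          simp only [Polynomial.eval_mul, Polynomial.eval_C, Polynomial.eval_pow, Polynomial.eval_X]
          exact mul_comm _ _
      have hz := hball x hx y₀ (hroots y₀ (Polynomial.isRoot_of_mem_roots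
        (Multiset.mem_toFinset.mp hy₀))) fun i => by
          rw [← coeff_sum_C_mul_X_pow (fun i => (g i).1 (x, y₀)) i, hp, Polynomial.coeff_zero]
      exact congrArg Prod.fst hz
    · exact (continuous_fst.tendsto (0 : X × ℂ)).eventually hf
  let mk := Ideal.Quotient.mkₐ ℂ J
  let φ : (AnFun X ⧸ J.comap (fstHom X)) →ₐ[ℂ] AnFun (X × ℂ) ⧸ J :=
    Ideal.quotientMapₐ J (fstHom X) le_rfl
  let Φ : (Fin b → AnFun X ⧸ J.comap (fstHom X)) →ₗ[ℂ] AnFun (X × ℂ) ⧸ J :=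
    ∑ j : Fin b, (LinearMap.mulRight ℂ (mk (sndFun X ^ (j : ℕ))))
      ∘ₗ φ.toLinearMap ∘ₗ LinearMap.proj j
  refine Module.Finite.of_surjective Φ fun u => ?_
  obtain ⟨f, rfl⟩ := Ideal.Quotient.mk_surjective u
  obtain ⟨q, r, hqr⟩ := exists_div hk hk0 hgk f
  refine ⟨fun j => Ideal.Quotient.mk _ (r j), ?_⟩
  have h1 : Φ (fun j => Ideal.Quotient.mk _ (r j)) = mk (ofCoeffs r) := by
    simp [Φ, ofCoeffs, φ, mk]
  rw [h1]
  refine (Ideal.Quotient.eq.mpr ?_).symm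
  refine mem_of_eventuallyEq hJ (g := q * g i₀) ?_ (J.mul_mem_left _ (hgJ i₀))
  filter_upwards [hqr] with z hz
  exact sub_eq_iff_eq_add.mpr hz

/-- The finiteness property is invariant under linear isomorphisms. -/
theorem finite_of_equiv {E F : Type*} [NormedAddCommGroup E] [NormedSpace ℂ E]
    [NormedAddCommGroup F] [NormedSpace ℂ F] (e : E ≃L[ℂ] F) {J : Ideal (AnFun E)}
    (h : Module.Finite ℂ (AnFun F ⧸ J.comap (pullback (e : E →L[ℂ] F)))) :
    Module.Finite ℂ (AnFun E ⧸ J) := by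
  have hsurj : Function.Surjective (pullback (e : E →L[ℂ] F)) := fun f =>
    ⟨pullback (e.symm : F →L[ℂ] E) f, Subtype.ext (funext fun z => by simp)⟩
  exact Module.Finite.of_surjective
    (Ideal.quotientMapₐ J (pullback (e : E →L[ℂ] F)) le_rfl).toLinearMap
    (Ideal.quotientMap_surjective (H := le_rfl) hsurj)

/-- A function analytic at `0` vanishing near `0` along every line through `0` vanishes near `0`. -/
theorem eventually_eq_zero_of_lines {E : Type*} [NormedAddCommGroup E] [NormedSpace ℂ E]
    [Nontrivial E] {f : E → ℂ} (hf : AnalyticAt ℂ f 0)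
    (h : ∀ v ≠ 0, ∀ᶠ t : ℂ in 𝓝 0, f (t • v) = 0) : f =ᶠ[𝓝 0] 0 := by
  obtain ⟨δ, hδ, hball⟩ := Metric.eventually_nhds_iff_ball.mp hf.eventually_analyticAt
  refine Filter.mem_of_superset (Metric.ball_mem_nhds 0 hδ) fun v hv => ?_
  let U : Set ℂ := (fun t : ℂ => t • v) ⁻¹' Metric.ball 0 δ
  have hU : Convex ℝ U := by
    have hl : IsLinearMap ℝ fun t : ℂ => t • v :=
      ⟨fun s t => add_smul s t v, fun c t => smul_assoc c t v⟩
    exact (convex_ball (0 : E) δ).is_linear_preimage hl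
  have han : AnalyticOnNhd ℂ (fun t : ℂ => f (t • v)) U := fun t ht =>
    (hball _ ht).fun_comp (f := fun t : ℂ => t • v) (by fun_prop)
  have h0 : (0 : ℂ) ∈ U := by simpa [U] using hδ
  have hv0 : ∀ᶠ t : ℂ in 𝓝 0, f (t • v) = 0 := by
    rcases eq_or_ne v 0 with rfl | hv
    · obtain ⟨w, hw⟩ := exists_ne (0 : E)
      have := (h w hw).self_of_nhds
      simp_all
    · exact h v hv
  have := han.eqOn_zero_of_preconnected_of_eventuallyEq_zero hU.isPreconnected h0 hv0
    (show (1 : ℂ) ∈ U by simpa [U] using hv)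
  simpa using this

theorem finiteCodim_of_subsingleton {E : Type*} [NormedAddCommGroup E] [NormedSpace ℂ E]
    [Subsingleton E] : FiniteCodim E := fun N g _ J _ _ => by
  refine Module.Finite.of_surjective (Algebra.linearMap ℂ (AnFun E ⧸ J)) fun u => ?_
  obtain ⟨f, rfl⟩ := Ideal.Quotient.mk_surjective u
  refine ⟨f.1 0, congrArg (Ideal.Quotient.mk J) (Subtype.ext (funext fun z => ?_))⟩
  rw [Subsingleton.elim z 0]
  rfl

/-- The induction step: passing from hyperplanes to the whole space. -/
theorem finiteCodim_of_hyperplane {E : Type*} [NormedAddCommGroup E] [NormedSpace ℂ E]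
    [Nontrivial E] (hX : FiniteCodim X)
    (he : ∀ v : E, v ≠ 0 → ∃ e : E ≃L[ℂ] X × ℂ, e v = (0, 1)) : FiniteCodim E := by
  intro N g hg J hJ hgJ
  obtain ⟨i, v, hi0, hv⟩ : ∃ i, ∃ v ≠ 0, ¬ ∀ᶠ t : ℂ in 𝓝 0, (g i).1 (t • v) = 0 := by
    by_contra! hno
    have h1 : ∀ᶠ z in 𝓝 (0 : E), z = 0 := by
      filter_upwards [hg, Filter.eventually_all.mpr fun i =>
        eventually_eq_zero_of_lines (analyticAt (g i)) (hno i)] with z hz h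
      exact hz h
    have := Module.punctured_nhds_neBot ℂ E (0 : E)
    obtain ⟨z, hz, hz0⟩ := ((h1.filter_mono nhdsWithin_le_nhds).and
      (self_mem_nhdsWithin : {(0 : E)}ᶜ ∈ 𝓝[≠] (0 : E))).exists
    exact hz0 hz
  obtain ⟨e, hev⟩ := he v hi0
  have hev' : e.symm (0, 1) = v := by rw [← hev, e.symm_apply_apply]
  refine finite_of_equiv e ?_
  let g' : Fin N → AnFun (X × ℂ) := fun i => pullback (e.symm : X × ℂ →L[ℂ] E) (g i)
  have hgv : ∀ y : ℂ, (g' i).1 (0, y) = (g i).1 (y • v) := fun y => by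
    rw [← hev', ← map_smul]
    simp [g']
  have han : AnalyticAt ℂ (fun t : ℂ => (g i).1 (t • v)) 0 :=
    (analyticAt (g i)).fun_comp_of_eq (f := fun t : ℂ => t • v) (by fun_prop) (zero_smul ℂ v)
  obtain ⟨b, k, hk, hk0, hgk⟩ := (han.exists_eventuallyEq_pow_smul_nonzero_iff).mpr hv
  refine finite_of_regular hX (g := g') (i₀ := i) ?_ (fun f hf => hJ _ ?_) (fun j => ?_) hk hk0
    (hgk.mono fun y hy => by rw [hgv, hy, sub_zero, smul_eq_mul])
  · have h1 : Filter.Tendsto (e.symm : X × ℂ → E) (𝓝 0) (𝓝 0) := by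
      simpa using e.symm.continuous.tendsto 0
    filter_upwards [h1.eventually hg] with z hz hz'
    exact e.symm.map_eq_zero_iff.mp (hz hz')
  · have h1 : Filter.Tendsto (e : E → X × ℂ) (𝓝 0) (𝓝 0) := by
      simpa using e.continuous.tendsto 0
    exact h1.eventually hf
  · have h1 : pullback (e : E →L[ℂ] X × ℂ) (g' j) = g j :=
      Subtype.ext (funext fun z => by simp [g'])
    exact Ideal.mem_comap.mpr (h1 ▸ hgJ j)

end AnFun

namespace AnFun

theorem finiteCodim_En (n : ℕ) : FiniteCodim (En n) := by
  induction n with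
  | zero => exact finiteCodim_of_subsingleton
  | succ n ih =>
    refine finiteCodim_of_hyperplane ih fun v hv => ?_
    let e₀ : En (n + 1) ≃L[ℂ] En n × ℂ := ContinuousLinearEquiv.ofFinrankEq (by simp)
    have h0 : e₀ v ≠ 0 := fun h => hv (e₀.map_eq_zero_iff.mp h)
    obtain ⟨B, hB⟩ := SeparatingDual.exists_continuousLinearEquiv_apply_eq (R := ℂ) h0
      (show ((0, 1) : En n × ℂ) ≠ 0 by simp)
    exact ⟨e₀.trans B, hB⟩

/-- The germ at `0` of a function analytic at `0`. -/
def toGerm (n : ℕ) : AnFun (En n) →ₐ[ℂ] AnalyticGerms n where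
  toFun f := ⟨(f.1 : (𝓝 (0 : En n)).Germ ℂ), f.1, f.2, rfl⟩
  map_one' := rfl
  map_mul' _ _ := rfl
  map_zero' := rfl
  map_add' _ _ := rfl
  commutes' _ := rfl

theorem toGerm_surjective (n : ℕ) : Function.Surjective (toGerm n) := by
  rintro ⟨_, f, hf, rfl⟩
  exact ⟨⟨f, hf⟩, rfl⟩

theorem toGerm_eq_iff {n : ℕ} {f g : AnFun (En n)} :
    toGerm n f = toGerm n g ↔ f.1 =ᶠ[𝓝 0] g.1 :=
  Subtype.ext_iff.trans Filter.Germ.coe_eq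

/-- The partial derivatives of a function analytic at `0`. -/
def partialDeriv {n : ℕ} {f : En n → ℂ} (hf : AnalyticAt ℂ f 0) (i : Fin n) : AnFun (En n) :=
  ⟨fun z => fderiv ℂ f z (EuclideanSpace.single i 1),
    analyticAt_clm_apply hf.fderiv analyticAt_const⟩

theorem jacobianIdeal_eq {n : ℕ} {f : En n → ℂ} (hf : AnalyticAt ℂ f 0) :
    jacobianIdeal f = Ideal.span (Set.range fun i => toGerm n (partialDeriv hf i)) := by
  refine congrArg Ideal.span (Set.ext fun g => ?_)
  constructor
  · rintro ⟨i, hi⟩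
    exact ⟨i, Subtype.ext hi.symm⟩
  · rintro ⟨i, rfl⟩
    exact ⟨i, rfl⟩

theorem clm_eq_zero_of_single {n : ℕ} {L : En n →L[ℂ] ℂ}
    (h : ∀ i, L (EuclideanSpace.single i 1) = 0) : L = 0 := by
  refine ContinuousLinearMap.coe_injective
    ((EuclideanSpace.basisFun (Fin n) ℂ).toBasis.ext fun i => ?_)
  simpa using h i

/-- The Milnor algebra of an isolated singularity is finite dimensional. -/
theorem finite_milnorAlgebra {n : ℕ} {f : En n → ℂ} (hf : AnalyticAt ℂ f 0)
    (hfs : IsolatedSingularityAt0 f) : Module.Finite ℂ (AnalyticGerms n ⧸ jacobianIdeal f) := by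
  have hfin : Module.Finite ℂ (AnFun (En n) ⧸ (jacobianIdeal f).comap (toGerm n)) := by
    refine finiteCodim_En n n (partialDeriv hf) ?_ _ (fun g hg => ?_) fun i => ?_
    · obtain ⟨-, U, hU, h⟩ := hfs
      filter_upwards [hU] with z hz h0
      by_contra hz0
      exact h z hz hz0 (clm_eq_zero_of_single h0)
    · have h0 : toGerm n g = 0 := by
        rw [← map_zero (toGerm n)]
        exact toGerm_eq_iff.mpr hg
      rw [Ideal.mem_comap, h0]
      exact Ideal.zero_mem _
    · rw [Ideal.mem_comap, jacobianIdeal_eq hf]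
      exact Ideal.subset_span ⟨i, rfl⟩
  exact Module.Finite.of_surjective
    (Ideal.quotientMapₐ (jacobianIdeal f) (toGerm n) le_rfl).toLinearMap
    (Ideal.quotientMap_surjective (H := le_rfl) (toGerm_surjective n))

end AnFun

/-- The multi-indices in `n` variables of degree `< k`. -/
def simplex (n k : ℕ) : Finset (Fin n →₀ ℕ) :=
  (Finset.range k).biUnion (Finset.finsuppAntidiag Finset.univ)

theorem mem_simplex {n k : ℕ} {α : Fin n →₀ ℕ} : α ∈ simplex n k ↔ ∑ i, α i < k := by
  simp [simplex, Finset.mem_finsuppAntidiag]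

theorem factorial_mul_card_simplex (n : ℕ) {k : ℕ} (hk : k ≠ 0) :
    n.factorial * (simplex n k).card = k.ascFactorial n := by
  obtain ⟨k, rfl⟩ := Nat.exists_eq_succ_of_ne_zero hk
  have h : (simplex n (k + 1)).card = (k + n).choose n := by
    rw [simplex, Finset.card_biUnion]
    · simp [Finset.card_finsuppAntidiag_nat_eq_multichoose, Nat.sum_range_multichoose]
    · intro i _ j _ hij
      refine Finset.disjoint_left.mpr fun α hi hj => hij ?_
      rw [Finset.mem_finsuppAntidiag] at hi hj
      exact hi.1.symm.trans hj.1
  rw [h, Nat.ascFactorial_eq_factorial_mul_choose]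

section UpperBound

variable {K R : Type*} [Field K] [CommRing R] [Algebra K R] {n : ℕ} (g : Fin n → R)

theorem span_range_pow_le (k : ℕ) : Ideal.span (Set.range g) ^ k ≤
    Ideal.span {x | ∃ β : Fin n →₀ ℕ, ∑ i, β i = k ∧ x = ∏ i, g i ^ β i} := by
  induction k with
  | zero =>
    rw [pow_zero, Ideal.one_eq_top, top_le_iff, Ideal.eq_top_iff_one]
    exact Ideal.subset_span ⟨0, by simp⟩
  | succ k ih =>
    rw [pow_succ']
    refine (Ideal.mul_mono_right ih).trans ?_
    rw [Ideal.span_mul_span', Ideal.span_le]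
    rintro _ ⟨_, ⟨i, rfl⟩, _, ⟨β, hβ, rfl⟩, rfl⟩
    refine Ideal.subset_span ⟨β + Finsupp.single i 1, ?_, ?_⟩
    · simp [Finset.sum_add_distrib, hβ, Finsupp.single_apply]
    · have h : ∏ j, g j ^ (Finsupp.single i 1 : Fin n →₀ ℕ) j = g i := by
        simp [Finsupp.single_apply, pow_ite]
      simp only [Finsupp.add_apply, pow_add, Finset.prod_mul_distrib, h]
      exact mul_comm _ _

/-- The span of products of elements of a finite family by monomials of degree `< k`. -/
def monomialSpan (K : Type*) [Field K] [Algebra K R] {μ : ℕ} (b : Fin μ → R) (k : ℕ) :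
    Submodule K R :=
  Submodule.span K (Set.range fun p : Fin μ × simplex n k => b p.1 * ∏ i, g i ^ p.2.1 i)

theorem mul_mem_monomialSpan {μ : ℕ} {b : Fin μ → R} {v : R}
    (hv : v ∈ Submodule.span K (Set.range b)) {k : ℕ} {β : Fin n →₀ ℕ} (hβ : ∑ i, β i < k) :
    v * ∏ i, g i ^ β i ∈ monomialSpan g K b k := by
  induction hv using Submodule.span_induction with
  | mem x hx =>
    obtain ⟨j, rfl⟩ := hx
    exact Submodule.subset_span ⟨(j, ⟨β, mem_simplex.mpr hβ⟩), rfl⟩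
  | zero => simp
  | add x y _ _ hx hy => rw [add_mul]; exact add_mem hx hy
  | smul c x _ hx => rw [smul_mul_assoc]; exact Submodule.smul_mem _ c hx

theorem monomialSpan_mono {μ : ℕ} (b : Fin μ → R) (k : ℕ) :
    monomialSpan g K b k ≤ monomialSpan g K b (k + 1) := by
  refine Submodule.span_le.mpr ?_
  rintro _ ⟨⟨j, β⟩, rfl⟩
  exact mul_mem_monomialSpan g (Submodule.subset_span ⟨j, rfl⟩)
    ((mem_simplex.mp β.2).trans (Nat.lt_succ_self k))

theorem monomialSpan_sup_pow {μ : ℕ} {b : Fin μ → R}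
    (hb : ∀ r : R, ∃ v ∈ Submodule.span K (Set.range b), r - v ∈ Ideal.span (Set.range g)) (k : ℕ) :
    ∀ r : R, ∃ u ∈ monomialSpan g K b k, r - u ∈ Ideal.span (Set.range g) ^ k := by
  set I := Ideal.span (Set.range g) with hI
  induction k with
  | zero => exact fun r => ⟨0, zero_mem _, by simp⟩
  | succ k ih =>
    have key : ∀ r ∈ I ^ k, ∃ u ∈ monomialSpan g K b (k + 1), r - u ∈ I ^ (k + 1) := by
      intro r hr
      refine Submodule.closure_induction (p := fun r _ =>
        ∃ u ∈ monomialSpan g K b (k + 1), r - u ∈ I ^ (k + 1)) ?_ ?_ ?_ (span_range_pow_le g k hr)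
      · exact ⟨0, zero_mem _, by simp⟩
      · rintro x y - - ⟨u, hu, hxu⟩ ⟨v, hv, hyv⟩
        exact ⟨u + v, add_mem hu hv, by rw [add_sub_add_comm]; exact add_mem hxu hyv⟩
      · rintro r _ ⟨β, hβ, rfl⟩
        obtain ⟨v, hv, hrv⟩ := hb r
        refine ⟨_, mul_mem_monomialSpan g hv (hβ.trans_lt (Nat.lt_succ_self k)), ?_⟩
        rw [smul_eq_mul, ← sub_mul, pow_succ']
        refine Ideal.mul_mem_mul hrv ?_
        rw [← hβ, ← Finset.prod_pow_eq_pow_sum]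
        refine Ideal.prod_mem_prod fun i _ => Ideal.pow_mem_pow ?_ _
        exact Ideal.subset_span (Set.mem_range_self i)
    intro r
    obtain ⟨u, hu, hru⟩ := ih r
    obtain ⟨v, hv, hruv⟩ := key _ hru
    exact ⟨u + v, add_mem (monomialSpan_mono g b k hu) hv, by rwa [← sub_sub]⟩

/-- The dimension of `R / I ^ k` is at most that of `R / I` times the number of monomials of
degree `< k` in generators of `I`. -/
theorem finite_and_finrank_quotient_pow_le {I : Ideal R} (hI : I = Ideal.span (Set.range g))
    [Module.Finite K (R ⧸ I)] (k : ℕ) :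
    Module.Finite K (R ⧸ I ^ k) ∧
      Module.finrank K (R ⧸ I ^ k) ≤ Module.finrank K (R ⧸ I) * (simplex n k).card := by
  let B := Module.finBasis K (R ⧸ I)
  choose b hb using fun j => Ideal.Quotient.mk_surjective (B j)
  have hb' : ∀ r : R, ∃ v ∈ Submodule.span K (Set.range b), r - v ∈ Ideal.span (Set.range g) := by
    intro r
    refine ⟨∑ j, B.repr (Ideal.Quotient.mk I r) j • b j, Submodule.sum_mem _ fun j _ =>
      Submodule.smul_mem _ _ (Submodule.subset_span ⟨j, rfl⟩), ?_⟩
    rw [← hI, ← Ideal.Quotient.eq]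
    have h1 := map_sum (Ideal.Quotient.mkₐ K I)
      (fun j => B.repr (Ideal.Quotient.mk I r) j • b j) Finset.univ
    simp only [map_smul, Ideal.Quotient.mkₐ_eq_mk, hb] at h1
    rw [h1, B.sum_repr]
  let f : Fin (Module.finrank K (R ⧸ I)) × simplex n k → R ⧸ I ^ k :=
    fun p => Ideal.Quotient.mkₐ K (I ^ k) (b p.1 * ∏ i, g i ^ p.2.1 i)
  have hspan : Submodule.span K (Set.range f) = ⊤ := by
    rw [eq_top_iff]
    intro x _
    obtain ⟨r, rfl⟩ := Ideal.Quotient.mk_surjective x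
    obtain ⟨u, hu, hru⟩ := monomialSpan_sup_pow g hb' k r
    have h1 : Submodule.span K (Set.range f)
        = (monomialSpan g K b k).map (Ideal.Quotient.mkₐ K (I ^ k)).toLinearMap := by
      rw [monomialSpan, Submodule.map_span, ← Set.range_comp]
      rfl
    rw [h1, Ideal.Quotient.eq.mpr (hI ▸ hru)]
    exact ⟨u, hu, rfl⟩
  refine ⟨Module.finite_def.mpr ⟨(Set.finite_range f).toFinset, by simpa using hspan⟩, ?_⟩
  refine (finrank_le_of_span_eq_top hspan).trans_eq ?_
  rw [Fintype.card_prod, Fintype.card_fin, Fintype.card_coe]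

end UpperBound

/-- The asymptotic comparison of dimensions. -/
theorem pow_lt_of_card_le {n d μ : ℕ} (hd : d ≠ 0) (hn : n ≠ 0)
    (h : ∀ s, s ≠ 0 → (simplex n (d * (2 * n * s))).card + s ^ n
      ≤ μ * (simplex n (2 * n * s)).card) : d ^ n < μ := by
  by_contra! hμ
  have key : ∀ s, s ≠ 0 → (d * (2 * n * s)) ^ n + s ^ n ≤ (d * (2 * n * s + n)) ^ n := by
    intro s hs
    have hk : 2 * n * s ≠ 0 := by positivity
    calc (d * (2 * n * s)) ^ n + s ^ n
        ≤ (d * (2 * n * s)).ascFactorial n + n.factorial * s ^ n :=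
          Nat.add_le_add (Nat.pow_succ_le_ascFactorial _ _)
            (Nat.le_mul_of_pos_left _ n.factorial_pos)
      _ = n.factorial * ((simplex n (d * (2 * n * s))).card + s ^ n) := by
          rw [mul_add, factorial_mul_card_simplex n (mul_ne_zero hd hk)]
      _ ≤ n.factorial * (d ^ n * (simplex n (2 * n * s)).card) := by
          gcongr
          exact (h s hs).trans (Nat.mul_le_mul_right _ hμ)
      _ = d ^ n * (2 * n * s).ascFactorial n := by
          rw [← factorial_mul_card_simplex n hk]
          ring
      _ ≤ d ^ n * (2 * n * s + n) ^ n := by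
          gcongr
          obtain ⟨k, hk⟩ := Nat.exists_eq_succ_of_ne_zero hk
          rw [hk]
          exact (Nat.ascFactorial_le_pow_add _ _).trans (Nat.pow_le_pow_left (by omega) _)
      _ = _ := (mul_pow _ _ _).symm
  set C : ℕ := (2 * (d * n)) ^ n with hC
  have hs : n * (C + 1) ≠ 0 := by positivity
  set s := n * (C + 1) with hsdef
  have h1 : (C + 1) * s ^ n ≤ C * (s + 1) ^ n := by
    calc (C + 1) * s ^ n = (d * (2 * n * s)) ^ n + s ^ n := by
          rw [hC, add_mul, one_mul, ← mul_pow]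
          ring
      _ ≤ _ := key s hs
      _ ≤ (2 * (d * n) * (s + 1)) ^ n := Nat.pow_le_pow_left (by nlinarith) _
      _ = _ := by rw [mul_pow]
  have h2 : ((C : ℝ) + 1) * s ^ n ≤ C * (s + 1) ^ n := by exact_mod_cast h1
  have hs1 : (0 : ℝ) < s + 1 := by positivity
  have h3 := one_add_mul_le_pow (a := -(1 / ((s : ℝ) + 1))) (by
    have : 1 / ((s : ℝ) + 1) ≤ 1 := by
      rw [div_le_one hs1]
      linarith [(Nat.cast_nonneg s : (0 : ℝ) ≤ s)]
    linarith) n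
  have h4 : 1 + -(1 / ((s : ℝ) + 1)) = s / (s + 1) := by field_simp; ring
  rw [h4, div_pow, le_div_iff₀ (by positivity)] at h3
  have h5 : ((C : ℝ) + 1) * (1 + n * -(1 / ((s : ℝ) + 1))) ≤ C := by
    have hpos : (0 : ℝ) < (s + 1) ^ n := by positivity
    refine le_of_mul_le_mul_right ?_ hpos
    calc _ = ((C : ℝ) + 1) * ((1 + n * -(1 / ((s : ℝ) + 1))) * (s + 1) ^ n) := by ring
      _ ≤ _ := (mul_le_mul_of_nonneg_left h3 (by positivity)).trans h2
  have h6 : ((C : ℝ) + 1) * ((s : ℝ) + 1 - n) ≤ C * (s + 1) := by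
    have : ((C : ℝ) + 1) * ((s : ℝ) + 1 - n)
        = ((C : ℝ) + 1) * (1 + n * -(1 / ((s : ℝ) + 1))) * (s + 1) := by field_simp; ring
    rw [this]
    exact mul_le_mul_of_nonneg_right h5 hs1.le
  have h7 : (s : ℝ) = n * (C + 1) := by rw [hsdef]; push_cast; ring
  nlinarith

namespace AnFun

section Curve

variable {E : Type*} [NormedAddCommGroup E] [NormedSpace ℂ E]

/-- The ideal of functions vanishing to order at least `D` along a curve. -/
def orderIdeal {γ : ℂ → E} (hγ : AnalyticAt ℂ γ 0) (hγ0 : γ 0 = 0) (D : ℕ) : Ideal (AnFun E) where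
  carrier := {f | ∃ h : ℂ → ℂ, AnalyticAt ℂ h 0 ∧ ∀ᶠ t in 𝓝 0, f.1 (γ t) = t ^ D * h t}
  zero_mem' := ⟨0, analyticAt_const, .of_forall fun t => by simp⟩
  add_mem' := by
    rintro f g ⟨h, hh, hf⟩ ⟨k, hk, hg⟩
    refine ⟨h + k, hh.add hk, ?_⟩
    filter_upwards [hf, hg] with t ht ht'
    exact (congrArg₂ (· + ·) ht ht').trans (mul_add _ _ _).symm
  smul_mem' := by
    rintro c f ⟨h, hh, hf⟩
    refine ⟨fun t => c.1 (γ t) * h t, ((analyticAt c).fun_comp_of_eq hγ hγ0).mul hh, ?_⟩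
    filter_upwards [hf] with t ht
    exact (congrArg (c.1 (γ t) * ·) ht).trans (mul_left_comm _ _ _)

variable {γ : ℂ → E} (hγ : AnalyticAt ℂ γ 0) (hγ0 : γ 0 = 0)

theorem orderIdeal_mul_le (D D' : ℕ) :
    orderIdeal hγ hγ0 D * orderIdeal hγ hγ0 D' ≤ orderIdeal hγ hγ0 (D + D') := by
  refine Ideal.mul_le.mpr ?_
  rintro f ⟨h, hh, hf⟩ g ⟨k, hk, hg⟩
  refine ⟨fun t => h t * k t, hh.mul hk, ?_⟩
  filter_upwards [hf, hg] with t ht ht'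
  refine (congrArg₂ (· * ·) ht ht').trans ?_
  ring

theorem orderIdeal_pow_le (D k : ℕ) :
    orderIdeal hγ hγ0 D ^ k ≤ orderIdeal hγ hγ0 (D * k) := by
  induction k with
  | zero =>
    intro f _
    exact ⟨fun t => f.1 (γ t), (analyticAt f).fun_comp_of_eq hγ hγ0, .of_forall fun t => by simp⟩
  | succ k ih =>
    rw [pow_succ, mul_add, mul_one]
    exact (Ideal.mul_mono_left ih).trans (orderIdeal_mul_le hγ hγ0 _ _)

theorem mem_orderIdeal_of_eventuallyEq {D : ℕ} {f g : AnFun E} (hfg : f.1 =ᶠ[𝓝 0] g.1)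
    (hg : g ∈ orderIdeal hγ hγ0 D) : f ∈ orderIdeal hγ hγ0 D := by
  obtain ⟨h, hh, hg⟩ := hg
  have hc : Filter.Tendsto γ (𝓝 0) (𝓝 0) := by
    have := hγ.continuousAt.tendsto
    rwa [hγ0] at this
  refine ⟨h, hh, ?_⟩
  filter_upwards [hc.eventually hfg, hg] with t ht ht'
  exact ht.trans ht'

theorem mem_orderIdeal_of_isBigO {D : ℕ} {f : AnFun E}
    (h : (fun t => f.1 (γ t)) =O[𝓝[≠] 0] fun t : ℂ => t ^ D) : f ∈ orderIdeal hγ hγ0 D := by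
  have han : AnalyticAt ℂ (fun t => f.1 (γ t)) 0 := (analyticAt f).fun_comp_of_eq hγ hγ0
  have hle : (D : ℕ∞) ≤ analyticOrderAt (fun t => f.1 (γ t)) 0 := by
    by_contra! hlt
    obtain ⟨N, hN⟩ := ENat.ne_top_iff_exists.mp (ne_top_of_lt hlt)
    rw [← hN, Nat.cast_lt] at hlt
    obtain ⟨k, hk, hk0, hfk⟩ := han.analyticOrderAt_eq_natCast.mp hN.symm
    have h1 : k =O[𝓝[≠] 0] fun t : ℂ => t ^ (D - N) := by
      obtain ⟨C, hC⟩ := h.bound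
      refine Asymptotics.IsBigO.of_bound C ?_
      filter_upwards [hC, hfk.filter_mono nhdsWithin_le_nhds, self_mem_nhdsWithin] with t ht ht' ht0
      have ht0 : 0 < ‖t‖ ^ N := pow_pos (norm_pos_iff.mpr ht0) _
      rw [ht', sub_zero, smul_eq_mul, norm_mul, norm_pow, norm_pow] at ht
      rw [norm_pow]
      refine le_of_mul_le_mul_left (ht.trans_eq ?_) ht0
      rw [mul_left_comm, ← pow_add, Nat.add_sub_cancel' hlt.le]
    have h2 : Filter.Tendsto (fun t : ℂ => t ^ (D - N)) (𝓝[≠] 0) (𝓝 0) := by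
      have : Filter.Tendsto (fun t : ℂ => t ^ (D - N)) (𝓝 0) (𝓝 (0 ^ (D - N))) :=
        (continuous_pow _).tendsto 0
      rw [zero_pow (Nat.sub_ne_zero_of_lt hlt)] at this
      exact this.mono_left nhdsWithin_le_nhds
    exact hk0 (tendsto_nhds_unique (hk.continuousAt.tendsto.mono_left nhdsWithin_le_nhds)
      (h1.trans_tendsto h2))
  obtain ⟨k, hk, hfk⟩ := (natCast_le_analyticOrderAt han).mp hle
  exact ⟨k, hk, hfk.mono fun t ht => by simpa using ht⟩

end Curve

/-- Elements of powers of the ideal generated by functions of order `≥ D` along a curve have large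
order along this curve. -/
theorem mem_orderIdeal_of_toGerm_mem {n N : ℕ} {g : Fin N → AnFun (En n)} {γ : ℂ → En n}
    (hγ : AnalyticAt ℂ γ 0) (hγ0 : γ 0 = 0) {D : ℕ} (hg : ∀ i, g i ∈ orderIdeal hγ hγ0 D) {k : ℕ}
    {f : AnFun (En n)}
    (hf : toGerm n f ∈ Ideal.span (Set.range fun i => toGerm n (g i)) ^ k) :
    f ∈ orderIdeal hγ hγ0 (D * k) := by
  have h1 : Ideal.span (Set.range fun i => toGerm n (g i))
      = (Ideal.span (Set.range g)).map (toGerm n) := by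
    rw [Ideal.map_span, ← Set.range_comp]
    rfl
  rw [h1, ← Ideal.map_pow] at hf
  obtain ⟨f', hf', hff'⟩ := (Ideal.mem_map_iff_of_surjective _ (toGerm_surjective n)).mp hf
  refine mem_orderIdeal_of_eventuallyEq hγ hγ0 (toGerm_eq_iff.mp hff'.symm)
    (orderIdeal_pow_le hγ hγ0 D k (Ideal.pow_right_mono (Ideal.span_le.mpr ?_) k hf'))
  rintro _ ⟨i, rfl⟩
  exact hg i

end AnFun

/-- A polynomial vanishes in weighted degrees smaller than its order along all weighted curves. -/
theorem coeff_eq_zero_of_order {σ : Type*} [Fintype σ] {p : MvPolynomial σ ℂ} (w : σ → ℕ) {D : ℕ}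
    (hp : ∀ x : σ → ℂ, ∃ h : ℂ → ℂ, AnalyticAt ℂ h 0 ∧
      ∀ᶠ t in 𝓝 0, MvPolynomial.eval (fun i => t ^ w i * x i) p = t ^ D * h t)
    {α : σ →₀ ℕ} (hα : ∑ i, w i * α i < D) : p.coeff α = 0 := by
  classical
  let q : MvPolynomial σ ℂ := ∑ β ∈ p.support,
    if ∑ i, w i * β i = ∑ i, w i * α i then MvPolynomial.monomial β (p.coeff β) else 0
  have hq : q = 0 := by
    refine MvPolynomial.funext fun x => ?_
    obtain ⟨h, hh, hpx⟩ := hp x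
    obtain ⟨δ, hδ, hball⟩ := Metric.eventually_nhds_iff_ball.mp (hpx.and hh.eventually_analyticAt)
    let Q : Polynomial ℂ := ∑ β ∈ p.support,
      Polynomial.C (p.coeff β * ∏ i, x i ^ β i) * Polynomial.X ^ (∑ i, w i * β i)
    have hdvd := prod_X_sub_C_dvd_of_mul_eq (U := Metric.ball 0 δ) Metric.isOpen_ball
      (h := fun _ => 1) (Q := h) continuousOn_const
      (fun y hy => (hball y hy).2.continuousAt.continuousWithinAt)
      (Multiset.replicate D 0)
      (fun y hy => by rw [Multiset.eq_of_mem_replicate hy]; exact Metric.mem_ball_self hδ)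
      (fun _ _ => one_ne_zero) Q (fun t ht => by
        have h1 := (hball t ht).1
        rw [MvPolynomial.eval_eq'] at h1
        rw [Multiset.map_replicate, Multiset.prod_replicate, map_zero, sub_zero,
          Polynomial.eval_pow, Polynomial.eval_X, mul_one, mul_comm, ← h1,
          Polynomial.eval_finsetSum]
        refine Finset.sum_congr rfl fun β _ => ?_
        simp only [Polynomial.eval_mul, Polynomial.eval_C, Polynomial.eval_pow, Polynomial.eval_X,
          mul_pow, Finset.prod_mul_distrib, ← pow_mul, Finset.prod_pow_eq_pow_sum]
        ring)
    rw [Multiset.map_replicate, Multiset.prod_replicate, map_zero, sub_zero,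
      Polynomial.X_pow_dvd_iff] at hdvd
    have h2 := hdvd _ hα
    rw [map_zero, ← h2, Polynomial.finsetSum_coeff, map_sum]
    refine Finset.sum_congr rfl fun β _ => ?_
    rw [Polynomial.coeff_C_mul, Polynomial.coeff_X_pow]
    by_cases hβ : ∑ i, w i * β i = ∑ i, w i * α i
    · rw [if_pos hβ, if_pos hβ.symm, MvPolynomial.eval_monomial, mul_one,
        Finsupp.prod_fintype _ _ fun i => pow_zero _]
    · rw [if_neg hβ, if_neg (Ne.symm hβ), map_zero, mul_zero]
  by_contra hne
  refine hne ?_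
  have h3 : q.coeff α = p.coeff α := by
    rw [MvPolynomial.coeff_sum, Finset.sum_eq_single α]
    · simp
    · intro β _ hβ
      split_ifs
      · rw [MvPolynomial.coeff_monomial, if_neg hβ]
      · exact MvPolynomial.coeff_zero _
    · exact fun h => absurd (MvPolynomial.mem_support_iff.mpr hne) h
  rw [← h3, hq, MvPolynomial.coeff_zero]

section InitialTerm

variable {E : Type*} [NormedAddCommGroup E] [NormedSpace ℂ E]

/-- **Cauchy estimate** along a curve through `0`. -/
theorem isBigO_fderiv_comp {h : E → ℂ} (hh : AnalyticAt ℂ h 0) {m : ℕ}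
    (hO : h =O[𝓝 0] fun z => ‖z‖ ^ (m + 1)) {γ : ℂ → E} {M : ℝ}
    (hγ : ∀ᶠ t in 𝓝 0, ‖γ t‖ ≤ M * ‖t‖) (u : E) :
    (fun t => fderiv ℂ h (γ t) u) =O[𝓝[≠] 0] fun t : ℂ => t ^ m := by
  obtain ⟨C, hC0, hC⟩ := hO.exists_nonneg
  obtain ⟨δ, hδ, hball⟩ :=
    Metric.eventually_nhds_iff_ball.mp (hC.bound.and hh.eventually_analyticAt)
  have hsmall : ∀ᶠ t : ℂ in 𝓝 0, (M + ‖u‖) * ‖t‖ < δ := by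
    have h1 : Filter.Tendsto (fun t : ℂ => (M + ‖u‖) * ‖t‖) (𝓝 0) (𝓝 0) := by
      have : Continuous fun t : ℂ => (M + ‖u‖) * ‖t‖ := by fun_prop
      simpa using this.tendsto 0
    exact h1.eventually_lt_const hδ
  refine Asymptotics.IsBigO.of_bound (C * (M + ‖u‖) ^ (m + 1)) ?_
  filter_upwards [(hγ.and hsmall).filter_mono nhdsWithin_le_nhds, self_mem_nhdsWithin]
    with t ⟨hγt, ht⟩ ht0
  have ht0 : 0 < ‖t‖ := norm_pos_iff.mpr ht0
  have hnorm : ∀ s : ℂ, ‖s‖ ≤ ‖t‖ → ‖γ t + s • u‖ ≤ (M + ‖u‖) * ‖t‖ := fun s hs => by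
    refine (norm_add_le _ _).trans ?_
    rw [norm_smul, add_mul, mul_comm ‖u‖]
    gcongr
  have hmem : ∀ s : ℂ, ‖s‖ ≤ ‖t‖ → γ t + s • u ∈ Metric.ball 0 δ := fun s hs =>
    mem_ball_zero_iff.mpr ((hnorm s hs).trans_lt ht)
  have hdiff : ∀ s : ℂ, ‖s‖ ≤ ‖t‖ → DifferentiableAt ℂ (fun s : ℂ => h (γ t + s • u)) s :=
    fun s hs => (hball _ (hmem s hs)).2.differentiableAt.comp s
      (by fun_prop : DifferentiableAt ℂ (fun s : ℂ => γ t + s • u) s)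
  have hderiv : deriv (fun s : ℂ => h (γ t + s • u)) 0 = fderiv ℂ h (γ t) u := by
    have h1 := (hball _ (hmem 0 (by simp))).2.differentiableAt.hasFDerivAt
    have h2 : HasDerivAt (fun s : ℂ => γ t + s • u) u 0 := by
      simpa using ((hasDerivAt_id (0 : ℂ)).smul_const u).const_add (γ t)
    simpa [Function.comp_def] using (h1.comp_hasDerivAt (0 : ℂ) h2).deriv
  have key := Complex.norm_deriv_le_of_forall_mem_sphere_norm_le (c := 0) (R := ‖t‖)
    (C := C * ((M + ‖u‖) * ‖t‖) ^ (m + 1)) (f := fun s : ℂ => h (γ t + s • u)) ht0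
    (DifferentiableOn.diffContOnCl (fun s hs =>
      (hdiff s (by
        rw [closure_ball _ ht0.ne'] at hs
        exact mem_closedBall_zero_iff.mp hs)).differentiableWithinAt))
    (fun s hs => by
      have hs : ‖s‖ = ‖t‖ := by simpa using hs
      refine (hball _ (hmem s hs.le)).1.trans ?_
      rw [norm_pow, norm_norm]
      gcongr
      exact hnorm s hs.le)
  rw [hderiv] at key
  refine key.trans_eq ?_
  rw [norm_pow, mul_pow, pow_succ ‖t‖]
  field_simp

theorem fderiv_homogeneous {P : E → ℂ} (hP : Differentiable ℂ P) {d : ℕ}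
    (hhom : ∀ (c : ℂ) z, P (c • z) = c ^ (d + 1) * P z) {c : ℂ} (hc : c ≠ 0) (z : E) :
    fderiv ℂ P (c • z) = c ^ d • fderiv ℂ P z := by
  have h1 : HasFDerivAt (fun z => P (c • z))
      ((fderiv ℂ P (c • z)).comp (c • ContinuousLinearMap.id ℂ E)) z :=
    (hP (c • z)).hasFDerivAt.comp z ((hasFDerivAt_id z).const_smul c)
  have h2 : HasFDerivAt (fun z => P (c • z)) (c ^ (d + 1) • fderiv ℂ P z) z := by
    simp only [hhom]
    exact (hP z).hasFDerivAt.const_mul _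
  ext u
  have h3 := congrArg (fun L : E →L[ℂ] ℂ => L u) (h1.unique h2)
  simp only [ContinuousLinearMap.comp_apply, smul_apply, ContinuousLinearMap.id_apply,
    map_smul, smul_eq_mul] at h3 ⊢
  refine mul_left_cancel₀ hc (h3.trans ?_)
  ring

theorem fderiv_smul_eq_zero {P : E → ℂ} (hP : ContDiff ℂ 1 P) {d : ℕ}
    (hhom : ∀ (c : ℂ) z, P (c • z) = c ^ (d + 1) * P z) {z : E} (hz : fderiv ℂ P z = 0) (c : ℂ) :
    fderiv ℂ P (c • z) = 0 := by
  have hcont : Continuous fun c : ℂ => fderiv ℂ P (c • z) :=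
    (hP.continuous_fderiv one_ne_zero).comp (by fun_prop)
  have hEq : Set.EqOn (fun c : ℂ => fderiv ℂ P (c • z)) (fun _ => 0) {0}ᶜ := fun c hc => by
    have h1 := fderiv_homogeneous (hP.differentiable one_ne_zero) hhom hc z
    rw [hz] at h1
    exact h1.trans (ContinuousLinearMap.ext fun u => mul_zero (c ^ d))
  exact congrFun (hcont.ext_on (dense_compl_singleton 0) continuous_const hEq) c

/-- Along a curve `t ↦ t (a + t v)`, the derivative of `f` vanishes to the order prescribed by its
initial term, and to higher order when `a` is a critical point of the initial term. -/
theorem isBigO_fderiv_of_initial {f P : E → ℂ} (hf : AnalyticAt ℂ f 0) (hP : ContDiff ℂ 2 P)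
    (hP0 : AnalyticAt ℂ P 0) {d : ℕ} (hhom : ∀ (c : ℂ) z, P (c • z) = c ^ (d + 1) * P z)
    (hfP : (fun z => f z - P z) =O[𝓝 0] fun z => ‖z‖ ^ (d + 2)) (a v u : E) :
    (fun t : ℂ => fderiv ℂ f (t • (a + t • v)) u) =O[𝓝[≠] 0] (fun t : ℂ => t ^ d) ∧
    (fderiv ℂ P a = 0 →
      (fun t : ℂ => fderiv ℂ f (t • (a + t • v)) u) =O[𝓝[≠] 0] fun t : ℂ => t ^ (d + 1)) := by
  have hγ : ∀ᶠ t : ℂ in 𝓝 0, ‖t • (a + t • v)‖ ≤ (‖a‖ + ‖v‖) * ‖t‖ := by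
    filter_upwards [Metric.closedBall_mem_nhds (0 : ℂ) one_pos] with t ht
    rw [norm_smul, mul_comm]
    gcongr
    refine (norm_add_le _ _).trans ?_
    gcongr
    rw [norm_smul]
    exact mul_le_of_le_one_left (norm_nonneg _) (mem_closedBall_zero_iff.mp ht)
  have h1 := isBigO_fderiv_comp (hf.sub hP0) hfP hγ u
  have h0 : Filter.Tendsto (fun t : ℂ => t • (a + t • v)) (𝓝 0) (𝓝 0) := by
    have : Continuous fun t : ℂ => t • (a + t • v) := by fun_prop
    simpa using this.tendsto 0
  have h2 : (fun t : ℂ => fderiv ℂ f (t • (a + t • v)) u) =ᶠ[𝓝[≠] 0] fun t : ℂ =>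
      t ^ d * fderiv ℂ P (a + t • v) u + fderiv ℂ (f - P) (t • (a + t • v)) u := by
    filter_upwards [(h0.eventually hf.eventually_analyticAt).filter_mono nhdsWithin_le_nhds,
      self_mem_nhdsWithin] with t ht ht0
    have hPd := hP.differentiable two_ne_zero
    rw [fderiv_sub ht.differentiableAt (hPd _), fderiv_homogeneous hPd hhom ht0]
    simp
  have hdiff : DifferentiableAt ℂ (fun t : ℂ => fderiv ℂ P (a + t • v) u) 0 := by
    have h3 : Differentiable ℂ (fderiv ℂ P) :=
      (hP.fderiv_right (m := 1) (by norm_num)).differentiable one_ne_zero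
    have h4 : Differentiable ℂ fun t : ℂ => fderiv ℂ P (a + t • v) := h3.comp (by fun_prop)
    exact (h4 0).clm_apply (differentiableAt_const u)
  have hle : (fun t : ℂ => t ^ (d + 1)) =O[𝓝[≠] 0] fun t : ℂ => t ^ d := by
    have h5 : (fun t : ℂ => t) =O[𝓝[≠] 0] fun _ => (1 : ℂ) :=
      (continuous_id.continuousAt.isBigO_one ℂ).mono nhdsWithin_le_nhds
    simpa [pow_succ] using (Asymptotics.isBigO_refl (fun t : ℂ => t ^ d) (𝓝[≠] 0)).mul h5
  refine ⟨h2.trans_isBigO (.add ?_ (h1.trans hle)), fun ha => h2.trans_isBigO (.add ?_ h1)⟩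
  · have h5 : (fun t : ℂ => fderiv ℂ P (a + t • v) u) =O[𝓝[≠] 0] fun _ => (1 : ℂ) :=
      (hdiff.continuousAt.isBigO_one ℂ).mono nhdsWithin_le_nhds
    simpa using (Asymptotics.isBigO_refl (fun t : ℂ => t ^ d) (𝓝[≠] 0)).mul h5
  · have h5 : (fun t : ℂ => fderiv ℂ P (a + t • v) u) =O[𝓝[≠] 0] fun t : ℂ => t := by
      have := hdiff.isBigO_sub.mono (nhdsWithin_le_nhds (s := {0}ᶜ))
      simpa [ha] using this
    simpa [pow_succ] using (Asymptotics.isBigO_refl (fun t : ℂ => t ^ d) (𝓝[≠] 0)).mul h5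

end InitialTerm

theorem card_le_finrank_quotient {K R σ : Type*} [Field K] [CommRing R] [Algebra K R]
    {J : Ideal R} [Module.Finite K (R ⧸ J)] (Ψ : MvPolynomial σ K →ₐ[K] R)
    (S : Finset (σ →₀ ℕ)) (hS : ∀ p, Ψ p ∈ J → ∀ α ∈ S, p.coeff α = 0) :
    S.card ≤ Module.finrank K (R ⧸ J) := by
  classical
  have hli : LinearIndependent K fun α : S =>
      Ideal.Quotient.mkₐ K J (Ψ (MvPolynomial.monomial α.1 1)) := by
    refine Fintype.linearIndependent_iff.mpr fun c hc α => ?_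
    let p : MvPolynomial σ K := ∑ β : S, MvPolynomial.monomial β.1 (c β)
    have hp : Ideal.Quotient.mkₐ K J (Ψ p) = 0 := by
      rw [← hc, map_sum, map_sum]
      refine Finset.sum_congr rfl fun β _ => ?_
      rw [← map_smul, ← map_smul, MvPolynomial.smul_monomial, smul_eq_mul, mul_one]
    have h := hS p (Ideal.Quotient.eq_zero_iff_mem.mp hp) α.1 α.2
    rw [MvPolynomial.coeff_sum, Finset.sum_eq_single α] at h
    · simpa using h
    · exact fun β _ hβ => by
        rw [MvPolynomial.coeff_monomial, if_neg fun h => hβ (Subtype.ext h)]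
    · exact fun h => absurd (Finset.mem_univ α) h
  simpa using hli.fintype_card_le_finrank

namespace AnFun

/-- Polynomials in the coordinates given by a linear map, as analytic functions. -/
def polyComp {n : ℕ} (B : En n →L[ℂ] En n) : MvPolynomial (Fin n) ℂ →ₐ[ℂ] AnFun (En n) :=
  MvPolynomial.aeval fun i => ⟨fun z => B z i, by
    exact ((EuclideanSpace.proj i).comp B).analyticAt 0⟩

theorem polyComp_apply {n : ℕ} (B : En n →L[ℂ] En n) (p : MvPolynomial (Fin n) ℂ) (z : En n) :
    (polyComp B p).1 z = MvPolynomial.eval (fun i => B z i) p := by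
  induction p using MvPolynomial.induction_on with
  | C a =>
    rw [MvPolynomial.eval_C, ← MvPolynomial.algebraMap_eq, AlgHom.commutes]
    rfl
  | add p q hp hq =>
    rw [map_add, map_add, ← hp, ← hq]
    rfl
  | mul_X p i hp =>
    rw [map_mul, map_mul, ← hp, MvPolynomial.eval_X, polyComp, MvPolynomial.aeval_X]
    rfl

theorem coeff_eq_zero_of_toGerm_polyComp_mem {n N : ℕ} (A : En n ≃L[ℂ] En n) (w : Fin n → ℕ)
    (hw : ∀ i, w i ≠ 0) {g : Fin N → AnFun (En n)} {D : ℕ}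
    (hg : ∀ i (x : Fin n → ℂ), (fun t : ℂ => (g i).1 (A (WithLp.toLp 2 fun j => t ^ w j * x j)))
      =O[𝓝[≠] 0] fun t => t ^ D) {k : ℕ} {p : MvPolynomial (Fin n) ℂ}
    (hp : toGerm n (polyComp A.symm p) ∈ Ideal.span (Set.range fun i => toGerm n (g i)) ^ k)
    {α : Fin n →₀ ℕ} (hα : ∑ i, w i * α i < D * k) : p.coeff α = 0 := by
  refine coeff_eq_zero_of_order w (D := D * k) (fun x => ?_) hα
  have hγ : AnalyticAt ℂ (fun t : ℂ => A (WithLp.toLp 2 fun j => t ^ w j * x j)) 0 := by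
    refine Differentiable.analyticAt (A.differentiable.comp ?_) 0
    exact (PiLp.continuousLinearEquiv 2 ℂ fun _ : Fin n => ℂ).symm.differentiable.comp
      (differentiable_pi.mpr fun j => by fun_prop)
  have hγ0 : A (WithLp.toLp 2 fun j => (0 : ℂ) ^ w j * x j) = 0 := by
    have : (fun j => (0 : ℂ) ^ w j * x j) = 0 := funext fun j => by simp [hw j]
    rw [this, WithLp.toLp_zero, map_zero]
  obtain ⟨h, hh, hev⟩ := mem_orderIdeal_of_toGerm_mem hγ hγ0
    (fun i => mem_orderIdeal_of_isBigO hγ hγ0 (hg i x)) hp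
  refine ⟨h, hh, hev.mono fun t ht => ?_⟩
  rw [polyComp_apply] at ht
  simpa using ht

end AnFun

/-- Exponents in a box touching the hyperplane of degree `b`. -/
def box {n : ℕ} (i₀ : Fin n) (b s : ℕ) : Finset (Fin n →₀ ℕ) :=
  (Fintype.piFinset fun _ => Finset.range s).map
    ((addRightEmbedding (Pi.single i₀ b)).trans Finsupp.equivFunOnFinite.symm.toEmbedding)

theorem card_box {n : ℕ} (i₀ : Fin n) (b s : ℕ) : (box i₀ b s).card = s ^ n := by
  simp [box]

theorem mem_box {n : ℕ} {i₀ : Fin n} {b s : ℕ} {α : Fin n →₀ ℕ} :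
    α ∈ box i₀ b s ↔ ∃ β : Fin n → ℕ, (∀ i, β i < s) ∧
      ∀ i, α i = β i + (Pi.single i₀ b : Fin n → ℕ) i := by
  simp only [box, Finset.mem_map, Fintype.mem_piFinset, Finset.mem_range]
  refine exists_congr fun β => and_congr_right fun _ => ?_
  rw [Finsupp.ext_iff]
  exact forall_congr' fun i => eq_comm

theorem disjoint_simplex_box {n : ℕ} (i₀ : Fin n) (b s : ℕ) :
    Disjoint (simplex n b) (box i₀ b s) := by
  refine Finset.disjoint_left.mpr fun α hα hα' => ?_
  obtain ⟨β, -, hβ⟩ := mem_box.mp hα'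
  have h1 := Finset.single_le_sum (f := fun i => α i) (fun _ _ => Nat.zero_le _)
    (Finset.mem_univ i₀)
  have h2 := hβ i₀
  rw [Pi.single_eq_same] at h2
  have h3 := mem_simplex.mp hα
  omega

theorem sum_weight_lt_of_mem_box {n : ℕ} {i₀ : Fin n} {b s : ℕ} (hs : s ≠ 0) {α : Fin n →₀ ℕ}
    (hα : α ∈ box i₀ b s) : ∑ i, (if i = i₀ then 1 else 2) * α i < b + 2 * n * s := by
  obtain ⟨β, hβs, hβ⟩ := mem_box.mp hα
  have h1 : ∀ i, (if i = i₀ then 1 else 2) * α i ≤ 2 * (s - 1) + if i = i₀ then b else 0 := by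
    intro i
    have h2 := hβs i
    have h3 := hβ i
    rw [Pi.single_apply] at h3
    split_ifs at h3 ⊢ <;> omega
  have hn : 0 < n := i₀.pos
  calc ∑ i, (if i = i₀ then 1 else 2) * α i
      ≤ ∑ i, (2 * (s - 1) + if i = i₀ then b else 0) := Finset.sum_le_sum fun i _ => h1 i
    _ = b + 2 * n * (s - 1) := by
      rw [Finset.sum_add_distrib]
      simp
      ring
    _ < b + 2 * n * s := by
      gcongr
      omega

open AnFun in
/-- The Milnor number of a function whose initial term has a nonzero critical point. -/
theorem pow_lt_milnorNumber {n d : ℕ} (hd : d ≠ 0) {f P : En n → ℂ} (hf : AnalyticAt ℂ f 0)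
    (hfs : IsolatedSingularityAt0 f) (hPs : ContDiff ℂ 2 P) (hP0 : AnalyticAt ℂ P 0)
    (hhom : ∀ (c : ℂ) z, P (c • z) = c ^ (d + 1) * P z)
    (hfP : (fun z => f z - P z) =O[𝓝 0] fun z => ‖z‖ ^ (d + 2))
    (hP : ∃ z, z ≠ 0 ∧ fderiv ℂ P z = 0) : d ^ n < milnorNumber f := by
  obtain ⟨z₀, hz₀, hPz₀⟩ := hP
  obtain ⟨i₀⟩ : Nonempty (Fin n) := by
    by_contra h
    rw [not_nonempty_iff] at h
    exact hz₀ (Subsingleton.elim _ _)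
  have hsingle : EuclideanSpace.single i₀ (1 : ℂ) ≠ 0 := by simp
  obtain ⟨A, hA⟩ := SeparatingDual.exists_continuousLinearEquiv_apply_eq (R := ℂ) hsingle hz₀
  have hfin := finite_milnorAlgebra hf hfs
  refine pow_lt_of_card_le hd i₀.pos.ne' fun s hs => ?_
  set k := 2 * n * s with hk
  obtain ⟨hfink, hle⟩ := finite_and_finrank_quotient_pow_le (K := ℂ)
    (fun i => toGerm n (partialDeriv hf i)) (jacobianIdeal_eq hf) k
  refine le_trans ?_ hle
  rw [← card_box i₀ (d * k) s, ← Finset.card_union_of_disjoint (disjoint_simplex_box i₀ _ s)]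
  refine card_le_finrank_quotient ((toGerm n).comp (polyComp A.symm)) _ fun p hp α hα => ?_
  rw [jacobianIdeal_eq hf] at hp
  obtain hα | hα := Finset.mem_union.mp hα
  · refine coeff_eq_zero_of_toGerm_polyComp_mem A (fun _ => 1) (fun _ => one_ne_zero) (D := d)
      (fun i x => ?_) hp (by simpa using mem_simplex.mp hα)
    refine (isBigO_fderiv_of_initial hf hPs hP0 hhom hfP (A (WithLp.toLp 2 x)) 0
      (EuclideanSpace.single i 1)).1.congr_left fun t => ?_
    have hx : WithLp.toLp 2 (fun j => t ^ 1 * x j) = t • WithLp.toLp 2 x := by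
      ext j
      simp
    rw [hx, map_smul, smul_zero, add_zero]
    rfl
  · refine coeff_eq_zero_of_toGerm_polyComp_mem A (fun i => if i = i₀ then 1 else 2)
      (fun i => by split_ifs <;> simp) (D := d + 1) (fun i x => ?_) hp ?_
    · refine ((isBigO_fderiv_of_initial hf hPs hP0 hhom hfP (x i₀ • z₀)
        (A (WithLp.toLp 2 fun j => if j = i₀ then 0 else x j)) (EuclideanSpace.single i 1)).2
        (fderiv_smul_eq_zero (hPs.of_le one_le_two) hhom hPz₀ _)).congr_left fun t => ?_
      have hx : WithLp.toLp 2 (fun j => t ^ (if j = i₀ then 1 else 2) * x j)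
          = t • (x i₀ • EuclideanSpace.single i₀ 1
            + t • WithLp.toLp 2 fun j => if j = i₀ then 0 else x j) := by
        ext j
        by_cases hj : j = i₀
        · simp [hj]
        · simp [hj, sq, mul_assoc]
      rw [hx, map_smul, map_add, map_smul, map_smul, hA]
      rfl
    · rw [add_mul, one_mul]
      exact sum_weight_lt_of_mem_box hs hα

theorem HasInitialTerm.two_le {n m : ℕ} {f P : En n → ℂ} (hf0 : f 0 = 0)
    (hf1 : fderiv ℂ f 0 = 0) (h : HasInitialTerm f m P) : 2 ≤ m := by
  obtain ⟨p, hp, -, hP, hP0⟩ := h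
  by_contra! hm
  refine hP0 (funext fun z => ?_)
  rw [hP z]
  interval_cases m
  · rw [hp.coeff_zero, hf0, Pi.zero_apply]
  · have h1 : p 1 (Fin.snoc 0 z) = p 1 fun _ => z :=
      congrArg (p 1) (funext fun i => by
        rw [Subsingleton.elim (α := Fin 1) i (Fin.last 0), Fin.snoc_last])
    rw [← h1, ← continuousMultilinearCurryFin1_apply, ← hp.hasFDerivAt.fderiv, hf1]
    rfl

theorem HasInitialTerm.isBigO_sub {n m : ℕ} {f P : En n → ℂ} (h : HasInitialTerm f m P) :
    (fun z => f z - P z) =O[𝓝 0] fun z => ‖z‖ ^ (m + 1) := by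
  obtain ⟨p, hp, hlow, hP, -⟩ := h
  refine (hp.isBigO_sub_partialSum_pow (m + 1)).congr_left fun z => ?_
  rw [zero_add, FormalMultilinearSeries.partialSum, Finset.sum_range_succ,
    Finset.sum_eq_zero fun k hk => hlow k (Finset.mem_range.mp hk) z, zero_add, hP z]

theorem HasInitialTerm.contDiff {n m : ℕ} {f P : En n → ℂ} (h : HasInitialTerm f m P)
    {k : WithTop ℕ∞} : ContDiff ℂ k P := by
  obtain ⟨p, -, -, hP, -⟩ := h
  rw [funext hP]
  exact (p m).contDiff.comp (contDiff_pi.mpr fun _ => contDiff_id)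

theorem HasInitialTerm.map_smul {n m : ℕ} {f P : En n → ℂ} (h : HasInitialTerm f m P)
    (c : ℂ) (z : En n) : P (c • z) = c ^ m * P z := by
  obtain ⟨p, -, -, hP, -⟩ := h
  rw [hP, hP, (p m).map_smul_univ (fun _ => c) fun _ => z]
  simp

theorem milnor_gt_of_nonisolated_initial {n : ℕ}
    (f : En n → ℂ) (hf : AnalyticAt ℂ f 0) (hf0 : f 0 = 0)
    (hfsing : IsolatedSingularityAt0 f)
    -- `f` has algebraic multiplicity `m` with initial homogeneous term `P`
    (m : ℕ) (P : En n → ℂ) (hfi : HasInitialTerm f m P)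
    -- the partial derivatives of `P` have a common zero other than `0`
    (hP : ∃ z : En n, z ≠ 0 ∧ fderiv ℂ P z = 0) :
    (m - 1) ^ n < milnorNumber f := by
  obtain ⟨d, rfl⟩ := Nat.exists_eq_add_of_le' (hfi.two_le hf0 hfsing.1)
  exact pow_lt_milnorNumber d.succ_ne_zero hf hfsing hfi.contDiff
    (hfi.contDiff (k := ⊤)).contDiffAt.analyticAt hfi.map_smul hfi.isBigO_sub hP
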